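/- arXiv:1005.4987 — 2 statements merged into one kernel-verified Lean document; each statement's English description precedes it below -/
import Mathlib

section
/- Let Λ be an even unimodular lattice in ℝ^24 of minimal norm 4 (the Leech lattice), and let A, B ∈ Λ with ⟨A,A⟩ = ⟨B,B⟩ = 4 and ⟨A,B⟩ = −1. Then the set X2⁰ = { x ∈ Λ : ⟨x,x⟩ = 4, ⟨x,A⟩ = 2, ⟨x,B⟩ = 0 } has exactly 2025 elements, and the set X2⁰′ = { x ∈ Λ : ⟨x,x⟩ = 4, ⟨x,A⟩ = 0, ⟨x,B⟩ = −2 } also has exactly 2025 elements. -/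
open MeasureTheory Metric MvPolynomial
open scoped RealInnerProductSpace Classical

/-- Average of a polynomial over the sphere of radius `r` centered at the origin in `ℝⁿ`,
with respect to the (rotation-invariant, normalized) surface measure. -/
noncomputable def sphereAvg (n : ℕ) (r : ℝ) (f : MvPolynomial (Fin n) ℝ) : ℝ :=
  ⨍ u : sphere (0 : EuclideanSpace ℝ (Fin n)) 1,
    eval (fun i => r * (u : EuclideanSpace ℝ (Fin n)) i) f
    ∂((volume : Measure (EuclideanSpace ℝ (Fin n))).toSphere)

section
variable {E : Type*} [NormedAddCommGroup E] [InnerProductSpace ℝ E] [FiniteDimensional ℝ E]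

theorem summable_exp_mul_norm_sub_sq (L : Submodule ℤ E) [DiscreteTopology L]
    {a : ℝ} (ha : 0 < a) (C : ℝ) :
    Summable fun x : L ↦ Real.exp (C * ‖(x : E)‖ - a * ‖(x : E)‖ ^ 2) := by
  set n := Module.finrank ℤ L + 1
  have h1 : Summable fun x : L ↦ ‖x‖⁻¹ ^ n :=
    ZLattice.summable_norm_pow_inv L n (Nat.lt_succ_self _)
  obtain ⟨K, hK⟩ : ∃ K : ℝ, ∀ r : ℝ, 0 ≤ r → r ^ n * Real.exp (C * r - a * r ^ 2) ≤ K := by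
    refine ⟨n.factorial * Real.exp ((C + 1) ^ 2 / (4 * a)), fun r hr ↦ ?_⟩
    have h2 : r ^ n ≤ n.factorial * Real.exp r := by
      have := Real.pow_div_factorial_le_exp r hr n
      rwa [div_le_iff₀' (by positivity)] at this
    calc r ^ n * Real.exp (C * r - a * r ^ 2)
        ≤ (n.factorial * Real.exp r) * Real.exp (C * r - a * r ^ 2) := by gcongr
      _ = n.factorial * Real.exp (r + (C * r - a * r ^ 2)) := by rw [mul_assoc, Real.exp_add]
      _ ≤ _ := by
        gcongr
        rw [le_div_iff₀ (by positivity)]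
        nlinarith [sq_nonneg (2 * a * r - (C + 1))]
  refine Summable.of_norm_bounded_eventually (h1.mul_left K) ?_
  have h3 : ∀ᶠ x : L in Filter.cofinite, x ≠ 0 := by simp
  filter_upwards [h3] with x hx
  have hx' : 0 < ‖x‖ := norm_pos_iff.mpr hx
  rw [Real.norm_eq_abs, Real.abs_exp, inv_pow, ← div_eq_mul_inv, le_div_iff₀ (by positivity),
    mul_comm]
  exact hK ‖x‖ hx'.le

end

section
variable {ι : Type*} [Fintype ι]

theorem hasSum_integral_unitBox {G : (ι → ℝ) → ℂ} (hG : Integrable G) :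
    HasSum (fun m : ι → ℤ ↦ ∫ t in {t : ι → ℝ | ∀ i, t i ∈ Set.Ioc (0 : ℝ) (0 + 1)},
      G (t + fun i ↦ (m i : ℝ))) (∫ t, G t) := by
  have hmeas (a : ι → ℝ) : MeasurableSet {t : ι → ℝ | ∀ i, t i ∈ Set.Ioc (a i) (a i + 1)} :=
    MeasurableSet.univ_pi' fun i ↦ measurableSet_Ioc
  set s : (ι → ℤ) → Set (ι → ℝ) := fun m ↦ {t | ∀ i, t i ∈ Set.Ioc (m i : ℝ) (m i + 1)} with hs
  have hU : ⋃ m, s m = Set.univ := by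
    refine Set.eq_univ_of_forall fun t ↦ Set.mem_iUnion.mpr ⟨fun i ↦ ⌈t i⌉ - 1, fun i ↦ ?_⟩
    have h1 := Int.ceil_lt_add_one (t i)
    have h2 := Int.le_ceil (t i)
    constructor <;> push_cast <;> linarith
  have hd : Pairwise (Function.onFun Disjoint s) := by
    intro m n hmn
    refine Set.disjoint_left.mpr fun t ht ht' ↦ hmn (funext fun i ↦ ?_)
    have h1 := ht i
    have h2 := ht' i
    have h3 : (m i : ℝ) < n i + 1 := h1.1.trans_le h2.2
    have h4 : (n i : ℝ) < m i + 1 := h2.1.trans_le h1.2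
    norm_cast at h3 h4
    lia
  have h := hasSum_integral_iUnion (μ := volume) (f := G) (fun m : ι → ℤ ↦ hmeas fun i ↦ (m i : ℝ)) hd
    hG.integrableOn
  rw [hU, setIntegral_univ] at h
  refine h.congr_fun fun m ↦ ?_
  have hp := (measurePreserving_add_right volume (fun i ↦ (m i : ℝ))).setIntegral_preimage_emb
    (MeasurableEquiv.addRight (fun i ↦ (m i : ℝ))).measurableEmbedding G (s m)
  rw [← hp]
  congr 2
  ext t
  simp [hs, add_comm (_ : ℝ) (1 : ℝ)]

theorem continuous_tsum_translates {G : (ι → ℝ) → ℂ} (hG : Continuous G)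
    (hbound : ∀ R : ℝ, ∃ u : (ι → ℤ) → ℝ, Summable u ∧
      ∀ n t, ‖t‖ ≤ R → ‖G (t + fun i ↦ (n i : ℝ))‖ ≤ u n) :
    Continuous fun t ↦ ∑' n : ι → ℤ, G (t + fun i ↦ (n i : ℝ)) := by
  refine continuous_iff_continuousAt.mpr fun t ↦ ?_
  obtain ⟨u, hu, hb⟩ := hbound (‖t‖ + 1)
  refine ContinuousOn.continuousAt (s := Metric.ball 0 (‖t‖ + 1)) ?_
    (Metric.isOpen_ball.mem_nhds (by simp))
  exact continuousOn_tsum (fun n ↦ by fun_prop) hu fun n x hx ↦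
    hb n x (by simpa using (mem_ball_zero_iff.mp hx).le)

omit [Fintype ι] in
theorem exists_unitAddTorus_lift {F : (ι → ℝ) → ℂ} (hF : Continuous F)
    (hper : ∀ t (m : ι → ℤ), F (t + fun i ↦ (m i : ℝ)) = F t) :
    ∃ f : C(UnitAddTorus ι, ℂ), ∀ t : ι → ℝ, f (fun i ↦ (t i : UnitAddCircle)) = F t := by
  have hq : IsOpenQuotientMap
      (Pi.map fun (_ : ι) (x : ℝ) ↦ (x : UnitAddCircle)) :=
    IsOpenQuotientMap.piMap fun _ ↦ QuotientAddGroup.isOpenQuotientMap_mk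
  let f : UnitAddTorus ι → ℂ := fun x ↦ F fun i ↦ (AddCircle.equivIoc 1 0 (x i)).1
  have hf : ∀ t : ι → ℝ, f (fun i ↦ (t i : UnitAddCircle)) = F t := by
    intro t
    have h1 (i : ι) : ∃ m : ℤ, (AddCircle.equivIoc 1 0 (t i : UnitAddCircle)).1 = t i + m := by
      have h2 : (((AddCircle.equivIoc 1 0 (t i : UnitAddCircle)).1 : ℝ) : UnitAddCircle) = t i :=
        AddCircle.coe_equivIoc
      obtain ⟨m, hm⟩ := AddSubgroup.mem_zmultiples_iff.mp (QuotientAddGroup.eq.mp h2.symm)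
      exact ⟨m, by simpa using (eq_neg_add_iff_add_eq.mp hm).symm⟩
    choose m hm using h1
    simp only [f, hm]
    exact hper t m
  refine ⟨⟨f, hq.isQuotientMap.continuous_iff.mpr ?_⟩, hf⟩
  exact hF.congr fun t ↦ (hf t).symm

theorem hasSum_poisson_pi {G : (ι → ℝ) → ℂ} (hG : Continuous G) (hGi : Integrable G)
    (hbound : ∀ R : ℝ, ∃ u : (ι → ℤ) → ℝ, Summable u ∧
      ∀ n t, ‖t‖ ≤ R → ‖G (t + fun i ↦ (n i : ℝ))‖ ≤ u n)
    (hsum : Summable fun n : ι → ℤ ↦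
      ∫ v, Complex.exp (-(2 * Real.pi * Complex.I * ∑ i, (n i : ℂ) * v i)) * G v) :
    HasSum (fun n : ι → ℤ ↦
        ∫ v, Complex.exp (-(2 * Real.pi * Complex.I * ∑ i, (n i : ℂ) * v i)) * G v)
      (∑' n : ι → ℤ, G fun i ↦ (n i : ℝ)) := by
  obtain ⟨f, hf⟩ := exists_unitAddTorus_lift (continuous_tsum_translates hG hbound) (by
    intro t m
    rw [← (Equiv.addLeft m).tsum_eq fun n : ι → ℤ ↦ G (t + fun i ↦ (n i : ℝ))]
    refine tsum_congr fun n ↦ ?_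
    congr 1
    ext i
    simp [add_assoc])
  have hmF (n : ι → ℤ) (t : ι → ℝ) :
      UnitAddTorus.mFourier (-n) (fun i ↦ (t i : UnitAddCircle)) =
        Complex.exp (-(2 * Real.pi * Complex.I * ∑ i, (n i : ℂ) * t i)) := by
    simp only [UnitAddTorus.mFourier, ContinuousMap.coe_mk, Pi.neg_apply, fourier_coe_apply,
      Finset.mul_sum, ← Finset.sum_neg_distrib, Complex.exp_sum]
    refine Finset.prod_congr rfl fun i _ ↦ ?_
    congr 1
    push_cast
    ring
  have hcoef (n : ι → ℤ) : UnitAddTorus.mFourierCoeff f n =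
      ∫ v, Complex.exp (-(2 * Real.pi * Complex.I * ∑ i, (n i : ℂ) * v i)) * G v := by
    rw [UnitAddTorus.mFourierCoeff_eq_integral _ _ 0]
    set H : (ι → ℝ) → ℂ := fun v ↦
      Complex.exp (-(2 * Real.pi * Complex.I * ∑ i, (n i : ℂ) * v i)) * G v with hH
    have hnorm (v : ι → ℝ) :
        ‖Complex.exp (-(2 * Real.pi * Complex.I * ∑ i, (n i : ℂ) * v i))‖ = 1 := by
      rw [Complex.norm_exp]
      simp [Complex.mul_re]
    have hHc : Continuous H := by fun_prop
    have hHi : Integrable H := by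
      refine hGi.mono hHc.aestronglyMeasurable (.of_forall fun v ↦ ?_)
      rw [hH, norm_mul, hnorm, one_mul]
    obtain ⟨u, hu, hb⟩ := hbound 1
    set S : Set (ι → ℝ) := {t | ∀ i, t i ∈ Set.Ioc (0 : ℝ) (0 + 1)} with hS
    have hSm : MeasurableSet S := MeasurableSet.univ_pi' fun i ↦ measurableSet_Ioc
    have hSv : volume S = 1 := by
      have : S = Set.univ.pi fun _ ↦ Set.Ioc (0 : ℝ) 1 := by ext; simp [hS]
      rw [this, Real.volume_pi_Ioc]
      simp
    have hSn {t : ι → ℝ} (ht : t ∈ S) : ‖t‖ ≤ 1 := by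
      refine (pi_norm_le_iff_of_nonneg zero_le_one).mpr fun i ↦ ?_
      have := ht i
      rw [Real.norm_eq_abs, abs_le]
      constructor <;> linarith [this.1, this.2]
    have hH1 : HasSum (fun m : ι → ℤ ↦ ∫ t in S, H (t + fun i ↦ (m i : ℝ))) (∫ t, H t) :=
      hasSum_integral_unitBox hHi
    have hexp (t : ι → ℝ) (m : ι → ℤ) : H (t + fun i ↦ (m i : ℝ)) =
        Complex.exp (-(2 * Real.pi * Complex.I * ∑ i, (n i : ℂ) * t i)) *
          G (t + fun i ↦ (m i : ℝ)) := by
      rw [hH]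
      dsimp only
      rw [← hmF, ← hmF]
      congr 2
      ext i
      simp
    have hint (m : ι → ℤ) : IntegrableOn (fun t ↦ H (t + fun i ↦ (m i : ℝ))) S :=
      (hHi.comp_add_right _).integrableOn
    have hbd (m : ι → ℤ) {t : ι → ℝ} (ht : t ∈ S) : ‖H (t + fun i ↦ (m i : ℝ))‖ ≤ u m := by
      rw [hH, norm_mul, hnorm, one_mul]
      exact hb m t (hSn ht)
    have h2 := hasSum_integral_of_summable_integral_norm (μ := volume.restrict S) hint (by
      refine Summable.of_nonneg_of_le (fun m ↦ integral_nonneg fun t ↦ norm_nonneg _)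
        (fun m ↦ ?_) hu
      refine (setIntegral_mono_on (hint m).norm (by simp [hSv]) hSm
        (fun t ht ↦ hbd m ht)).trans ?_
      simp [Measure.real, hSv])
    rw [← h2.unique hH1]
    refine setIntegral_congr_fun hSm fun t ht ↦ ?_
    simp only [hexp]
    rw [tsum_mul_left, hmF, hf, smul_eq_mul]
  have h := UnitAddTorus.hasSum_mFourier_series_apply_of_summable (f := f)
    (by simpa only [funext hcoef] using hsum) (fun i ↦ ((0 : ℝ) : UnitAddCircle))
  rw [hf fun _ ↦ 0] at h
  simp only [hcoef] at h
  have h0 (n : ι → ℤ) : ((fun _ ↦ 0) + fun i ↦ (n i : ℝ)) = fun i ↦ (n i : ℝ) := zero_add _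
  simpa [UnitAddTorus.mFourier, h0] using h

end

section
variable {E : Type*} [NormedAddCommGroup E] [InnerProductSpace ℝ E] [FiniteDimensional ℝ E]

theorem exists_dual_equiv (L : Submodule ℤ E) [DiscreteTopology L] [IsZLattice ℝ L]
    (hdual : ∀ y : E, y ∈ L ↔ ∀ x ∈ L, ∃ k : ℤ, ⟪x, y⟫ = (k : ℝ))
    {ι : Type*} [Fintype ι] (b : Module.Basis ι ℤ L) :
    ∃ e : (ι → ℤ) ≃ L, ∀ n (v : ι → ℝ),
      ⟪((b.ofZLatticeBasis ℝ L).equivFun.symm v : E), (e n : E)⟫ = ∑ i, n i * v i := by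
  set c := b.ofZLatticeBasis ℝ L with hc
  let y : (ι → ℤ) → E := fun n ↦
    (InnerProductSpace.toDual ℝ E).symm (LinearMap.toContinuousLinearMap (∑ i, (n i : ℝ) • c.coord i))
  have hy (n : ι → ℤ) (v : ι → ℝ) : ⟪(c.equivFun.symm v : E), y n⟫ = ∑ i, n i * v i := by
    rw [real_inner_comm, InnerProductSpace.toDual_symm_apply]
    simp [Finsupp.single_apply, mul_comm]
  have hcb (i : ι) : c.equivFun.symm (Pi.single i 1) = (b i : E) := by
    simp [c]
  have hyb (n : ι → ℤ) (i : ι) : ⟪(b i : E), y n⟫ = n i := by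
    rw [← hcb, hy]
    simp [Pi.single_apply]
  have hmem (n : ι → ℤ) : y n ∈ L := by
    refine (hdual _).mpr fun x hx ↦ ⟨∑ i, n i * b.repr ⟨x, hx⟩ i, ?_⟩
    have : x = c.equivFun.symm fun i ↦ (b.repr ⟨x, hx⟩ i : ℝ) := by
      rw [LinearEquiv.eq_symm_apply]
      ext i
      exact Module.Basis.ofZLatticeBasis_repr_apply ℝ L b ⟨x, hx⟩ i
    calc ⟪x, y n⟫ = ⟪(c.equivFun.symm fun i ↦ (b.repr ⟨x, hx⟩ i : ℝ) : E), y n⟫ := by rw [← this]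
      _ = _ := by rw [hy]; push_cast; rfl
  refine ⟨Equiv.ofBijective (fun n ↦ ⟨y n, hmem n⟩) ⟨fun m n hmn ↦ ?_, fun z ↦ ?_⟩, hy⟩
  · ext i
    have := hyb m i
    rw [Subtype.mk.inj hmn, hyb] at this
    exact_mod_cast this.symm
  · choose n hn using fun i ↦ (hdual z).mp z.2 (b i) (b i).2
    refine ⟨n, Subtype.ext (ext_inner_left ℝ fun v ↦ ?_)⟩
    have : innerₗ E (y n) = innerₗ E (z : E) := c.ext fun i ↦ by
      simp [c, real_inner_comm (b i : E), hyb, hn]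
    simpa [real_inner_comm v] using congr($this v)

theorem integral_cexp_inner_mul_gaussian [MeasurableSpace E] [BorelSpace E] {b : ℂ} (hb : 0 < b.re)
    (y z : E) :
    ∫ v : E, Complex.exp (-(2 * Real.pi * Complex.I * ⟪v, y⟫)) *
        Complex.exp (-b * ‖v + z‖ ^ 2) =
      (Real.pi / b) ^ (Module.finrank ℝ E / 2 : ℂ) *
        (Complex.exp (2 * Real.pi * Complex.I * ⟪z, y⟫) *
          Complex.exp (-(Real.pi ^ 2 * ‖y‖ ^ 2 / b))) := by
  have hb0 : b ≠ 0 := fun h ↦ by simp [h] at hb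
  rw [← integral_sub_right_eq_self _ z]
  have h (v : E) : Complex.exp (-(2 * Real.pi * Complex.I * ⟪v - z, y⟫)) *
        Complex.exp (-b * ‖v - z + z‖ ^ 2) = Complex.exp (2 * Real.pi * Complex.I * ⟪z, y⟫) *
        Complex.exp (-b * ‖v‖ ^ 2 + (-(2 * Real.pi * Complex.I)) * ⟪y, v⟫) := by
    rw [← Complex.exp_add, ← Complex.exp_add, sub_add_cancel, inner_sub_left, real_inner_comm v y]
    congr 1
    push_cast
    ring
  simp only [h]
  rw [integral_const_mul, GaussianFourier.integral_cexp_neg_mul_sq_norm_add hb, mul_left_comm]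
  congr 3
  field_simp
  linear_combination (‖y‖ : ℂ) ^ 2 * 4 * Complex.I_sq

omit [InnerProductSpace ℝ E] [FiniteDimensional ℝ E] in
theorem norm_gaussian_add_le {b : ℂ} (hb : 0 < b.re) {R : ℝ} (x : E) {w : E} (hw : ‖w‖ ≤ R) :
    ‖Complex.exp (-b * ‖x + w‖ ^ 2)‖ ≤ Real.exp (2 * b.re * R * ‖x‖ - b.re * ‖x‖ ^ 2) := by
  rw [Complex.norm_exp]
  refine Real.exp_le_exp.mpr ?_
  have h1 : (-b * (‖x + w‖ : ℂ) ^ 2).re = -b.re * ‖x + w‖ ^ 2 := by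
    rw [← Complex.ofReal_pow, Complex.re_mul_ofReal, Complex.neg_re]
  have h2 : |‖x‖ - ‖w‖| ≤ ‖x + w‖ := by simpa using abs_norm_sub_norm_le x (-w)
  have h3 : (‖x‖ - ‖w‖) ^ 2 ≤ ‖x + w‖ ^ 2 := sq_le_sq.mpr (h2.trans (le_abs_self _))
  have h4 : ‖x‖ ^ 2 - 2 * R * ‖x‖ ≤ ‖x + w‖ ^ 2 := by
    nlinarith [mul_le_mul_of_nonneg_right hw (norm_nonneg x), sq_nonneg ‖w‖]
  rw [h1]
  nlinarith [mul_le_mul_of_nonneg_left h4 hb.le]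

theorem summable_gaussian_dual (L : Submodule ℤ E) [DiscreteTopology L] {b : ℂ} (hb : 0 < b.re)
    (z : E) : Summable fun y : L ↦ Complex.exp (2 * Real.pi * Complex.I * ⟪z, (y : E)⟫) *
      Complex.exp (-(Real.pi ^ 2 * ‖(y : E)‖ ^ 2 / b)) := by
  have hb0 : b ≠ 0 := fun h ↦ by simp [h] at hb
  have ha : 0 < Real.pi ^ 2 * (b⁻¹).re := by
    rw [Complex.inv_re]
    have := Complex.normSq_pos.mpr hb0
    positivity
  refine (summable_exp_mul_norm_sub_sq L ha 0).of_norm_bounded fun y ↦ ?_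
  rw [norm_mul, Complex.norm_exp, Complex.norm_exp, ← Real.exp_add]
  refine Real.exp_le_exp.mpr (le_of_eq ?_)
  have h1 : (-(Real.pi ^ 2 * (‖(y : E)‖ : ℂ) ^ 2 / b)).re =
      -(Real.pi ^ 2 * ‖(y : E)‖ ^ 2 * (b⁻¹).re) := by
    rw [div_eq_mul_inv, Complex.neg_re]
    norm_cast
    rw [Complex.re_ofReal_mul]
  rw [h1]
  simp [Complex.mul_re]
  ring

theorem exists_hasSum_gaussian (L : Submodule ℤ E) [DiscreteTopology L] [IsZLattice ℝ L]
    (hdual : ∀ y : E, y ∈ L ↔ ∀ x ∈ L, ∃ k : ℤ, ⟪x, y⟫ = (k : ℝ)) :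
    ∃ C : ℝ, ∀ (b : ℂ) (z : E), 0 < b.re →
      HasSum (fun y : L ↦ C * ((Real.pi / b) ^ (Module.finrank ℝ E / 2 : ℂ) *
        (Complex.exp (2 * Real.pi * Complex.I * ⟪z, (y : E)⟫) *
          Complex.exp (-(Real.pi ^ 2 * ‖(y : E)‖ ^ 2 / b)))))
      (∑' x : L, Complex.exp (-b * ‖(x : E) + z‖ ^ 2)) := by
  borelize E
  have := ZLattice.module_free ℝ L
  have := ZLattice.module_finite ℝ L
  let B := Module.Free.chooseBasis ℤ L
  obtain ⟨e, he⟩ := exists_dual_equiv L hdual B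
  let M : (Module.Free.ChooseBasisIndex ℤ L → ℝ) ≃L[ℝ] E := (B.ofZLatticeBasis ℝ L).equivFunL.symm
  have hMB (n : Module.Free.ChooseBasisIndex ℤ L → ℤ) :
      M (fun i ↦ (n i : ℝ)) = (B.equivFun.symm n : L) := by
    have : M (fun i ↦ (n i : ℝ)) = (B.ofZLatticeBasis ℝ L).equivFun.symm fun i ↦ (n i : ℝ) := rfl
    simp [this, Module.Basis.equivFun_symm_apply, Int.cast_smul_eq_zsmul]
  have := M.isAddHaarMeasure_map volume
  have hC := Measure.isAddLeftInvariant_eq_smul (Measure.map M volume) (volume : Measure E)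
  set C := Measure.addHaarScalarFactor (Measure.map M volume) (volume : Measure E)
  have hemb : MeasurableEmbedding M := M.toHomeomorph.measurableEmbedding
  refine ⟨C, fun b z hb ↦ ?_⟩
  have hchange (f : E → ℂ) : ∫ t, f (M t) = C * ∫ v, f v := by
    have h := hemb.integral_map (μ := volume) f
    rw [← h, hC, integral_smul_nnreal_measure, NNReal.smul_def, Complex.real_smul]
  have hcoef (n : Module.Free.ChooseBasisIndex ℤ L → ℤ) :
      ∫ v, Complex.exp (-(2 * Real.pi * Complex.I * ∑ i, (n i : ℂ) * v i)) *
          Complex.exp (-b * ‖M v + z‖ ^ 2) = C * ((Real.pi / b) ^ (Module.finrank ℝ E / 2 : ℂ) *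
        (Complex.exp (2 * Real.pi * Complex.I * ⟪z, (e n : E)⟫) *
          Complex.exp (-(Real.pi ^ 2 * ‖(e n : E)‖ ^ 2 / b)))) := by
    rw [← integral_cexp_inner_mul_gaussian hb, ← hchange]
    refine integral_congr_ae (.of_forall fun v ↦ ?_)
    have : ⟪M v, (e n : E)⟫ = ∑ i, n i * v i := he n v
    simp only [this]
    push_cast
    rfl
  have h := hasSum_poisson_pi (G := fun v ↦ Complex.exp (-b * ‖M v + z‖ ^ 2)) (by fun_prop) ?_ ?_ ?_
  · simp only [hcoef, hMB] at h
    rw [← B.equivFun.symm.toEquiv.tsum_eq fun x : L ↦ Complex.exp (-b * ‖(x : E) + z‖ ^ 2)]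
    exact e.hasSum_iff.mp h
  · have h1 : Integrable (fun v : E ↦ Complex.exp (-b * ‖v + z‖ ^ 2)) := by
      simpa using (GaussianFourier.integrable_cexp_neg_mul_sq_norm_add hb 0 (0 : E)).comp_add_right z
    have h2 : Integrable (fun v : E ↦ Complex.exp (-b * ‖v + z‖ ^ 2)) (Measure.map M volume) := by
      rw [hC]
      exact h1.smul_measure_nnreal
    exact hemb.integrable_map_iff.mp h2
  · intro R
    refine ⟨fun n ↦ _, B.equivFun.symm.toEquiv.summable_iff.mpr (summable_exp_mul_norm_sub_sq L hb
      (2 * b.re * (‖(M : (Module.Free.ChooseBasisIndex ℤ L → ℝ) →L[ℝ] E)‖ * R + ‖z‖))),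
      fun n t ht ↦ ?_⟩
    rw [map_add, hMB, add_comm (M t), add_assoc]
    refine norm_gaussian_add_le hb _ ((norm_add_le _ _).trans ?_)
    gcongr
    exact ((M : (Module.Free.ChooseBasisIndex ℤ L → ℝ) →L[ℝ] E).le_opNorm t).trans (by gcongr)
  · simp only [hcoef]
    exact e.summable_iff.mpr (((summable_gaussian_dual L hb z).mul_left _).mul_left _)

theorem tsum_gaussian_eq (L : Submodule ℤ E) [DiscreteTopology L] [IsZLattice ℝ L]
    (hdual : ∀ y : E, y ∈ L ↔ ∀ x ∈ L, ∃ k : ℤ, ⟪x, y⟫ = (k : ℝ)) {b : ℂ} (hb : 0 < b.re) (z : E) :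
    ∑' x : L, Complex.exp (-b * ‖(x : E) + z‖ ^ 2) =
      (Real.pi / b) ^ (Module.finrank ℝ E / 2 : ℂ) *
        ∑' y : L, Complex.exp (2 * Real.pi * Complex.I * ⟪z, (y : E)⟫) *
          Complex.exp (-(Real.pi ^ 2 * ‖(y : E)‖ ^ 2 / b)) := by
  obtain ⟨C, hC⟩ := exists_hasSum_gaussian L hdual
  have h1 := (hC b z hb).tsum_eq
  rw [tsum_mul_left, tsum_mul_left] at h1
  suffices C = 1 by rw [← h1, this, Complex.ofReal_one, one_mul]
  have h2 := (hC Real.pi 0 (by simpa using Real.pi_pos)).tsum_eq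
  have hpi : (Real.pi : ℂ) ≠ 0 := by exact_mod_cast Real.pi_ne_zero
  have h3 (x : L) : Complex.exp (-(Real.pi : ℂ) * ‖(x : E) + 0‖ ^ 2) =
      (Real.exp (-Real.pi * ‖(x : E)‖ ^ 2) : ℝ) := by
    push_cast
    rw [add_zero]
  have h4 (x : L) : Complex.exp (2 * Real.pi * Complex.I * ⟪(0 : E), (x : E)⟫) *
          Complex.exp (-(Real.pi ^ 2 * ‖(x : E)‖ ^ 2 / Real.pi)) =
      (Real.exp (-Real.pi * ‖(x : E)‖ ^ 2) : ℝ) := by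
    rw [inner_zero_left, Complex.ofReal_zero, mul_zero, Complex.exp_zero, one_mul]
    push_cast
    congr 1
    field_simp
  have hT : 0 < ∑' x : L, Real.exp (-Real.pi * ‖(x : E)‖ ^ 2) :=
    Summable.tsum_pos (by simpa using summable_exp_mul_norm_sub_sq L Real.pi_pos 0)
      (fun x ↦ (Real.exp_pos _).le) 0 (Real.exp_pos _)
  simp only [h3, h4] at h2
  rw [tsum_mul_left, tsum_mul_left, div_self hpi, Complex.one_cpow, one_mul, ← Complex.ofReal_tsum,
    ← Complex.ofReal_mul, Complex.ofReal_inj] at h2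
  exact (mul_eq_right₀ hT.ne').mp h2

end

section

theorem coeff_eq_of_hasSum_pow {a b : ℕ → ℂ} {f : ℝ → ℂ}
    (ha : ∀ s : ℝ, HasSum (fun n ↦ (s : ℂ) ^ n * a n) (f s))
    (hb : ∀ s : ℝ, HasSum (fun n ↦ (s : ℂ) ^ n * b n) (f s)) : a = b := by
  have key (a : ℕ → ℂ) (ha : ∀ s : ℝ, HasSum (fun n ↦ (s : ℂ) ^ n * a n) (f s)) :
      HasFPowerSeriesAt f (fun n ↦ ContinuousMultilinearMap.mkPiRing ℝ (Fin n) (a n)) 0 := by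
    refine hasFPowerSeriesAt_iff.mpr (.of_forall fun s ↦ ?_)
    simpa [FormalMultilinearSeries.coeff] using ha s
  have h := (key a ha).eq_formalMultilinearSeries (key b hb)
  ext n
  simpa [FormalMultilinearSeries.coeff] using congr(FormalMultilinearSeries.coeff $h n)

theorem hasSum_pow_exp_sq (d : ℂ) (s : ℝ) :
    HasSum (fun n ↦ (s : ℂ) ^ n * if Even n then d ^ (n / 2) / (n / 2).factorial else 0)
      (Complex.exp (d * s ^ 2)) := by
  have hinj : Function.Injective fun j : ℕ ↦ 2 * j := fun _ _ h ↦ by simpa using h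
  refine (hinj.hasSum_iff fun n hn ↦ ?_).mp ?_
  · have : ¬ Even n := fun ⟨j, hj⟩ ↦ hn ⟨j, by simp [hj, two_mul]⟩
    simp [this]
  · have := NormedSpace.expSeries_div_hasSum_exp (d * (s : ℂ) ^ 2)
    rw [← Complex.exp_eq_exp_ℂ] at this
    refine this.congr_fun fun j ↦ ?_
    simp [mul_pow, pow_mul]
    ring

variable {E : Type*} [NormedAddCommGroup E] [InnerProductSpace ℝ E] [FiniteDimensional ℝ E]

/-- The theta series of `L` with each vector weighted by the `k`-th power of its inner product
with `w`. -/
noncomputable def thetaMoment (L : Submodule ℤ E) (w : E) (k : ℕ) (τ : ℂ) : ℂ :=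
  ∑' x : L, (⟪(x : E), w⟫ : ℂ) ^ k * Complex.exp (Real.pi * Complex.I * τ * ‖(x : E)‖ ^ 2)

variable (L : Submodule ℤ E) [DiscreteTopology L]

omit [InnerProductSpace ℝ E] [FiniteDimensional ℝ E] in
theorem norm_cexp_pi_mul (τ : ℂ) (x : E) :
    ‖Complex.exp (Real.pi * Complex.I * τ * ‖x‖ ^ 2)‖ = Real.exp (-(Real.pi * τ.im * ‖x‖ ^ 2)) := by
  rw [Complex.norm_exp, ← Complex.ofReal_pow, Complex.re_mul_ofReal]
  simp [Complex.mul_re]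

theorem summable_norm_theta_expansion (w : E) {τ : ℂ} (hτ : 0 < τ.im) (c : ℂ) :
    Summable fun p : L × ℕ ↦ ‖(c * ⟪(p.1 : E), w⟫) ^ p.2 / p.2.factorial *
      Complex.exp (Real.pi * Complex.I * τ * ‖(p.1 : E)‖ ^ 2)‖ := by
  have h1 (x : L) : HasSum (fun n : ℕ ↦ ‖(c * ⟪(x : E), w⟫) ^ n / n.factorial *
      Complex.exp (Real.pi * Complex.I * τ * ‖(x : E)‖ ^ 2)‖)
      (Real.exp (‖c‖ * |⟪(x : E), w⟫|) * Real.exp (-(Real.pi * τ.im * ‖(x : E)‖ ^ 2))) := by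
    have := (NormedSpace.expSeries_div_hasSum_exp (‖c‖ * |⟪(x : E), w⟫|)).mul_right
      (Real.exp (-(Real.pi * τ.im * ‖(x : E)‖ ^ 2)))
    rw [← Real.exp_eq_exp_ℝ] at this
    refine this.congr_fun fun n ↦ ?_
    simp [norm_cexp_pi_mul]
  refine (summable_prod_of_nonneg fun p ↦ norm_nonneg _).mpr ⟨fun x ↦ (h1 x).summable, ?_⟩
  simp only [(h1 _).tsum_eq]
  refine (summable_exp_mul_norm_sub_sq L (a := Real.pi * τ.im) (by positivity)
    (‖c‖ * ‖w‖)).of_nonneg_of_le (fun x ↦ by positivity) fun x ↦ ?_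
  rw [← Real.exp_add, ← sub_eq_add_neg, mul_assoc ‖c‖, mul_comm ‖w‖]
  gcongr
  exact abs_real_inner_le_norm _ _

omit [FiniteDimensional ℝ E] [DiscreteTopology L] in
theorem thetaMoment_expansion_aux (w : E) (c : ℂ) (s : ℝ) (k : ℕ) (τ : ℂ) :
    ∑' x : L, (c * s * ⟪(x : E), w⟫) ^ k / k.factorial *
      Complex.exp (Real.pi * Complex.I * τ * ‖(x : E)‖ ^ 2) =
    (s : ℂ) ^ k * (c ^ k * thetaMoment L w k τ / k.factorial) := by
  rw [thetaMoment, mul_div_right_comm, ← mul_assoc, ← tsum_mul_left]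
  refine tsum_congr fun x ↦ ?_
  ring

theorem hasSum_thetaMoment (w : E) {τ : ℂ} (hτ : 0 < τ.im) (c : ℂ) (s : ℝ) :
    HasSum (fun k ↦ (s : ℂ) ^ k * (c ^ k * thetaMoment L w k τ / k.factorial))
      (∑' x : L, Complex.exp (c * s * ⟪(x : E), w⟫) *
        Complex.exp (Real.pi * Complex.I * τ * ‖(x : E)‖ ^ 2)) := by
  have h := (summable_norm_theta_expansion L w hτ (c * s)).of_norm
  have h2 : ∀ x : L, ∑' n : ℕ, (c * s * ⟪(x : E), w⟫) ^ n / n.factorial *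
      Complex.exp (Real.pi * Complex.I * τ * ‖(x : E)‖ ^ 2) = Complex.exp (c * s * ⟪(x : E), w⟫) *
        Complex.exp (Real.pi * Complex.I * τ * ‖(x : E)‖ ^ 2) := by
    intro x
    rw [tsum_mul_right, Complex.exp_eq_exp_ℂ,
      (NormedSpace.expSeries_div_hasSum_exp (c * s * (⟪(x : E), w⟫ : ℂ))).tsum_eq]
  have h3 := h.prod_symm.prod.hasSum
  simp only [Prod.fst_swap, Prod.snd_swap, thetaMoment_expansion_aux] at h3
  refine (congrArg (HasSum _) ?_).mp h3
  simp only [← thetaMoment_expansion_aux, ← h2]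
  exact h.tsum_comm (f := fun x n ↦ _)

theorem summable_norm_thetaMoment (w : E) {τ : ℂ} (hτ : 0 < τ.im) (c : ℂ) (s : ℝ) :
    Summable fun k ↦ ‖(s : ℂ) ^ k * (c ^ k * thetaMoment L w k τ / k.factorial)‖ := by
  have h := summable_norm_theta_expansion L w hτ (c * s)
  refine h.prod_symm.prod.of_nonneg_of_le (fun _ ↦ norm_nonneg _) fun k ↦ ?_
  rw [← thetaMoment_expansion_aux]
  exact norm_tsum_le_tsum_norm (h.prod_symm.prod_factor k)

theorem thetaMoment_neg_inv [IsZLattice ℝ L]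
    (hdual : ∀ y : E, y ∈ L ↔ ∀ x ∈ L, ∃ k : ℤ, ⟪x, y⟫ = (k : ℝ)) {m : ℕ}
    (hm : Module.finrank ℝ E = 8 * m)
    (w : E) {τ : ℂ} (hτ : 0 < τ.im) (k : ℕ) :
    (2 * Real.pi * Complex.I) ^ k * thetaMoment L w k (-1 / τ) / k.factorial =
      τ ^ (4 * m) * ∑ p ∈ Finset.HasAntidiagonal.antidiagonal k,
        (if Even p.1 then (Real.pi * Complex.I * τ * ‖w‖ ^ 2) ^ (p.1 / 2) / (p.1 / 2).factorial
          else 0) *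
          ((2 * Real.pi * Complex.I * τ) ^ p.2 * thetaMoment L w p.2 τ / p.2.factorial) := by
  have hτ0 : τ ≠ 0 := fun h ↦ by simp [h] at hτ
  have hτ' : 0 < (-1 / τ).im := by
    rw [neg_div, one_div, Complex.neg_im, Complex.inv_im, neg_div, neg_neg]
    exact div_pos hτ (Complex.normSq_pos.mpr hτ0)
  have hpi : (Real.pi : ℂ) ≠ 0 := by exact_mod_cast Real.pi_ne_zero
  revert k
  rw [← funext_iff]
  refine coeff_eq_of_hasSum_pow (hasSum_thetaMoment L w hτ' (2 * Real.pi * Complex.I)) fun s ↦ ?_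
  have hprod := (summable_norm_thetaMoment L w hτ (2 * Real.pi * Complex.I * τ) s)
  have hexp := hasSum_pow_exp_sq (Real.pi * Complex.I * τ * ‖w‖ ^ 2) s
  have h1 := (summable_norm_sum_mul_antidiagonal_of_summable_norm hexp.summable.norm
    hprod).of_norm.hasSum
  rw [← tsum_mul_tsum_eq_tsum_sum_antidiagonal_of_summable_norm hexp.summable.norm hprod,
    hexp.tsum_eq, (hasSum_thetaMoment L w hτ _ s).tsum_eq] at h1
  have h2 := tsum_gaussian_eq L hdual (b := -(Real.pi * Complex.I * τ))
    (by simpa [Complex.mul_re] using mul_pos Real.pi_pos hτ) ((s : ℝ) • w)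
  have h3 : (Real.pi / -(Real.pi * Complex.I * τ)) ^ (Module.finrank ℝ E / 2 : ℂ) =
      (τ ^ (4 * m))⁻¹ := by
    have : (Module.finrank ℝ E / 2 : ℂ) = (4 * m : ℕ) := by
      rw [hm]; push_cast; ring
    rw [this, Complex.cpow_natCast, ← inv_pow]
    have h4 : (Real.pi : ℂ) / -(Real.pi * Complex.I * τ) = Complex.I * τ⁻¹ := by
      field_simp
      simp
    rw [h4, mul_pow, pow_mul Complex.I, Complex.I_pow_four, one_pow, one_mul]
  have h5 (x : L) : Complex.exp (-(-(Real.pi * Complex.I * τ)) * ‖(x : E) + s • w‖ ^ 2) =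
      Complex.exp (Real.pi * Complex.I * τ * ‖w‖ ^ 2 * s ^ 2) *
        (Complex.exp (2 * Real.pi * Complex.I * τ * s * ⟪(x : E), w⟫) *
        Complex.exp (Real.pi * Complex.I * τ * ‖(x : E)‖ ^ 2)) := by
    rw [← Complex.exp_add, ← Complex.exp_add]
    congr 1
    rw [← Complex.ofReal_pow ‖_ + _‖, norm_add_sq_real, inner_smul_right, norm_smul, mul_pow,
      Real.norm_eq_abs, sq_abs]
    push_cast
    ring
  have h6 (y : L) : Complex.exp (2 * Real.pi * Complex.I * ⟪s • w, (y : E)⟫) *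
          Complex.exp (-(Real.pi ^ 2 * ‖(y : E)‖ ^ 2 / -(Real.pi * Complex.I * τ))) =
      Complex.exp (2 * Real.pi * Complex.I * s * ⟪(y : E), w⟫) *
        Complex.exp (Real.pi * Complex.I * (-1 / τ) * ‖(y : E)‖ ^ 2) := by
    rw [inner_smul_left, real_inner_comm w]
    congr 2
    · simp
      ring
    · field_simp
      simp
  simp only [h5, h6] at h2
  rw [tsum_mul_left, h3, eq_inv_mul_iff_mul_eq₀ (pow_ne_zero _ hτ0)] at h2
  rw [← h2]
  refine (h1.mul_left (τ ^ (4 * m))).congr_fun fun n ↦ ?_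
  rw [mul_left_comm, Finset.mul_sum]
  congr 1
  refine Finset.sum_congr rfl fun p hp ↦ ?_
  rw [← Finset.HasAntidiagonal.mem_antidiagonal.mp hp, pow_add]
  ring

end

section

open UpperHalfPlane ModularForm ModularFormClass MatrixGroups EisensteinSeries ModularGroup
open scoped CongruenceSubgroup Real Manifold

/-- `f` is given on the upper half plane by the convergent power series `P` in
`q = exp (2 * π * I * τ)`. -/
def HasQSeries (f : ℍ → ℂ) (P : PowerSeries ℂ) : Prop :=
  ∀ τ : ℍ, HasSum (fun n ↦ P.coeff n * Function.Periodic.qParam 1 τ ^ n) (f τ)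

namespace HasQSeries

variable {f g : ℍ → ℂ} {P Q : PowerSeries ℂ}

theorem add (hf : HasQSeries f P) (hg : HasQSeries g Q) : HasQSeries (f + g) (P + Q) := fun τ ↦ by
  simpa [add_mul] using HasSum.add (hf τ) (hg τ)

theorem sub (hf : HasQSeries f P) (hg : HasQSeries g Q) : HasQSeries (f - g) (P - Q) := fun τ ↦ by
  simpa [sub_mul] using HasSum.sub (hf τ) (hg τ)

theorem smul (hf : HasQSeries f P) (c : ℂ) : HasQSeries (c • f) (c • P) := fun τ ↦ by
  simpa [mul_assoc] using HasSum.mul_left c (hf τ)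

theorem mul (hf : HasQSeries f P) (hg : HasQSeries g Q) : HasQSeries (f * g) (P * Q) := fun τ ↦ by
  have hF := (hf τ).summable.norm
  have hG := (hg τ).summable.norm
  have h := (summable_norm_sum_mul_antidiagonal_of_summable_norm hF hG).of_norm.hasSum
  rw [← tsum_mul_tsum_eq_tsum_sum_antidiagonal_of_summable_norm hF hG, (hf τ).tsum_eq,
    (hg τ).tsum_eq] at h
  refine h.congr_fun fun n ↦ ?_
  rw [PowerSeries.coeff_mul, Finset.sum_mul]
  refine Finset.sum_congr rfl fun p hp ↦ ?_
  rw [← Finset.HasAntidiagonal.mem_antidiagonal.mp hp, pow_add]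
  ring

theorem hasFPowerSeriesOnBall (hf : HasQSeries f P) :
    HasFPowerSeriesOnBall (fun q ↦ ∑' n, P.coeff n * q ^ n) (.ofScalars ℂ (P.coeff ·)) 0 1 := by
  have hs {q : ℂ} (hq : ‖q‖ < 1) : Summable fun n ↦ P.coeff n * q ^ n := by
    rcases eq_or_ne q 0 with rfl | hq0
    · exact summable_of_ne_finset_zero (s := {0}) fun n hn ↦ by simp_all
    · have h := hf ⟨_, Function.Periodic.im_invQParam_pos_of_norm_lt_one one_pos hq hq0⟩
      simpa [Function.Periodic.qParam_right_inv one_ne_zero hq0] using h.summable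
  refine ⟨ENNReal.le_of_forall_nnreal_lt fun r hr ↦ ?_, one_pos, fun {y} hy ↦ ?_⟩
  · refine FormalMultilinearSeries.le_radius_of_summable _ ?_
    simpa using (hs (q := (r : ℂ)) (by simpa using hr)).norm
  · rw [← ENNReal.coe_one, Metric.eball_coe, NNReal.coe_one, mem_ball_zero_iff] at hy
    simpa [mul_comm] using (hs hy).hasSum

theorem mdiff (hf : HasQSeries f P) : MDiff f := by
  rw [UpperHalfPlane.mdifferentiable_iff]
  have h (z : ℂ) (hz : z ∈ {z : ℂ | 0 < z.im}) : (f ∘ ofComplex) z =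
      ∑' n, P.coeff n * Function.Periodic.qParam 1 z ^ n := by
    simpa [ofComplex_apply_of_im_pos hz] using (hf ⟨z, hz⟩).tsum_eq.symm
  refine DifferentiableOn.congr ?_ h
  refine hf.hasFPowerSeriesOnBall.differentiableOn.comp
    (Function.Periodic.differentiable_qParam.differentiableOn) fun z hz ↦ ?_
  rw [← ENNReal.coe_one, Metric.eball_coe, NNReal.coe_one, mem_ball_zero_iff]
  exact Function.Periodic.norm_qParam_lt_one one_pos hz

theorem slash_eq (hf : HasQSeries f P) {k : ℤ} (hS : ∀ τ : ℍ, f (S • τ) = τ ^ k * f τ)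
    (γ : SL(2, ℤ)) : f ∣[k] γ = f := by
  refine SlashInvariantForm.slash_action_generators_SL2Z ?_ ?_ γ
  · ext τ
    rw [ModularForm.SL_slash_apply, hS, denom_S, mul_right_comm, ← zpow_add₀ τ.ne_zero]
    simp
  · ext τ
    have h : f (T • τ) = f τ := by
      refine (hf (T • τ)).unique ?_
      have hq : Function.Periodic.qParam 1 (T • τ : ℍ) = Function.Periodic.qParam 1 τ := by
        rw [modular_T_smul]
        simp [Function.Periodic.qParam, mul_add, Complex.exp_add]
      simpa only [hq] using hf τ
    have hd : denom T τ = 1 := by rw [ModularGroup.denom_apply]; simp [ModularGroup.coe_T]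
    rw [ModularForm.SL_slash_apply, h, hd, one_zpow, mul_one]

/-- A `q`-series of weight less than `24` for the full modular group vanishes as soon as its first
two coefficients do. -/
theorem eq_zero_of_coeff (hf : HasQSeries f P) {k : ℕ} (hk : k < 24)
    (hS : ∀ τ : ℍ, f (S • τ) = τ ^ k * f τ) (h0 : P.coeff 0 = 0) (h1 : P.coeff 1 = 0) :
    P = 0 := by
  have hS' : ∀ τ : ℍ, f (S • τ) = τ ^ (k : ℤ) * f τ := by simpa using hS
  have hfs : ∀ τ : ℍ, HasSum (fun n ↦ P.coeff n • Function.Periodic.qParam 1 τ ^ n) (f τ) := hf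
  let F : ModularForm 𝒮ℒ k :=
    { toFun := f
      slash_action_eq' := fun _ ⟨γ, hγ⟩ ↦ hγ ▸ hf.slash_eq hS' γ
      holo' := hf.mdiff
      bdd_at_cusps' {c} hc := by
        rw [Subgroup.IsArithmetic.isCusp_iff_isCusp_SL2Z] at hc
        rw [OnePoint.isBoundedAt_iff_forall_SL2Z hc]
        intro γ _
        rw [hf.slash_eq hS' γ]
        exact isBoundedAtImInfty_of_hasSum_qExpansion one_pos hfs }
  have hP : P = qExpansion 1 F := PowerSeries.ext
    (ModularFormClass.qExpansion_coeff_unique one_pos one_mem_strictPeriods_SL (f := F) hfs)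
  have hF : F = 0 := by
    refine sturm_bound_levelOne_nat ?_
    rw [← hP]
    refine lt_of_lt_of_le ?_ (PowerSeries.nat_le_order P 2 fun i hi ↦ by interval_cases i <;> assumption)
    exact_mod_cast (by omega : k / 12 < 2)
  rw [hP, hF]
  exact qExpansion_zero 1

end HasQSeries
end

section

open UpperHalfPlane ModularForm ModularFormClass MatrixGroups EisensteinSeries ModularGroup
open scoped CongruenceSubgroup Real Manifold

/-- `f` has a `q`-series whose first three coefficients are `a`, `b`, `c`. -/
def HasQJet (f : ℍ → ℂ) (a b c : ℂ) : Prop :=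
  ∃ P : PowerSeries ℂ, HasQSeries f P ∧ P.coeff 0 = a ∧ P.coeff 1 = b ∧ P.coeff 2 = c

namespace HasQJet

variable {f g : ℍ → ℂ} {a b c a' b' c' : ℂ}

theorem add (hf : HasQJet f a b c) (hg : HasQJet g a' b' c') :
    HasQJet (f + g) (a + a') (b + b') (c + c') := by
  obtain ⟨P, hP, rfl, rfl, rfl⟩ := hf
  obtain ⟨Q, hQ, rfl, rfl, rfl⟩ := hg
  exact ⟨_, hP.add hQ, map_add .., map_add .., map_add ..⟩

theorem sub (hf : HasQJet f a b c) (hg : HasQJet g a' b' c') :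
    HasQJet (f - g) (a - a') (b - b') (c - c') := by
  obtain ⟨P, hP, rfl, rfl, rfl⟩ := hf
  obtain ⟨Q, hQ, rfl, rfl, rfl⟩ := hg
  exact ⟨_, hP.sub hQ, map_sub .., map_sub .., map_sub ..⟩

theorem smul (hf : HasQJet f a b c) (d : ℂ) : HasQJet (d • f) (d * a) (d * b) (d * c) := by
  obtain ⟨P, hP, rfl, rfl, rfl⟩ := hf
  exact ⟨_, hP.smul d, by simp, by simp, by simp⟩

theorem mul (hf : HasQJet f a b c) (hg : HasQJet g a' b' c') :
    HasQJet (f * g) (a * a') (a * b' + b * a') (a * c' + b * b' + c * a') := by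
  obtain ⟨P, hP, rfl, rfl, rfl⟩ := hf
  obtain ⟨Q, hQ, rfl, rfl, rfl⟩ := hg
  refine ⟨_, hP.mul hQ, ?_, ?_, ?_⟩ <;>
    simp [PowerSeries.coeff_mul, Finset.Nat.antidiagonal_succ, add_assoc]

theorem eq_zero (hf : HasQJet f a b c) {k : ℕ} (hk : k < 24)
    (hS : ∀ τ : ℍ, f (S • τ) = τ ^ k * f τ) (ha : a = 0) (hb : b = 0) : c = 0 := by
  obtain ⟨P, hP, rfl, rfl, rfl⟩ := hf
  rw [hP.eq_zero_of_coeff hk hS ha hb, map_zero]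

end HasQJet

theorem modularForm_apply_S {k : ℕ} (f : ModularForm 𝒮ℒ k) (τ : ℍ) : f (S • τ) = τ ^ k * f τ := by
  have h := congrFun (f.slash_action_eq' _ ⟨S, rfl⟩) τ
  change ((f : ℍ → ℂ) ∣[(k : ℤ)] S) τ = f τ at h
  rw [ModularForm.SL_slash_apply, denom_S] at h
  rw [← h, mul_left_comm, ← zpow_natCast, ← zpow_add₀ τ.ne_zero]
  simp

theorem hasQJet_E {k : ℕ} (hk : 3 ≤ k) (hk2 : Even k) :
    HasQJet (E hk) 1 (-(2 * k / bernoulli k)) (-(2 * k / bernoulli k) * (1 + 2 ^ (k - 1))) := by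
  refine ⟨qExpansion 1 (E hk), ModularForm.hasSum_qExpansion _ one_pos one_mem_strictPeriods_SL, ?_, ?_, ?_⟩ <;>
    simp only [E_qExpansion_coeff hk hk2]
  · simp
  · simp
  · simp [ArithmeticFunction.sigma_apply, Nat.Prime.sum_divisors Nat.prime_two, add_comm]

theorem hasQJet_E₄ : HasQJet E₄ 1 240 2160 := by
  have hb : bernoulli 4 = -1 / 30 := by decide +kernel
  convert hasQJet_E (k := 4) (by norm_num) (by decide) using 1 <;> norm_num [hb]

theorem hasQJet_E₆ : HasQJet E₆ 1 (-504) (-16632) := by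
  have hb : bernoulli 6 = 1 / 42 := by decide +kernel
  convert hasQJet_E (k := 6) (by norm_num) (by decide) using 1 <;> norm_num [hb]

theorem hasQJet_E2 : HasQJet E2 1 (-24) (-72) := by
  refine ⟨.mk fun m ↦ if m = 0 then 1 else -24 * (ArithmeticFunction.sigma 1 m : ℂ),
    fun τ ↦ ?_, ?_, ?_, ?_⟩
  · simpa [Function.Periodic.qParam] using hasSum_qExpansion_E2 τ
  · simp
  · simp
  · norm_num [ArithmeticFunction.sigma_apply, Nat.Prime.sum_divisors Nat.prime_two]

theorem E2_apply_S (τ : ℍ) : E2 (S • τ) = τ ^ 2 * E2 τ + 6 / (π * Complex.I) * τ := by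
  have h := congrFun (E2_slash_action S) τ
  rw [ModularForm.SL_slash_apply, denom_S] at h
  have hτ : (τ : ℂ) ≠ 0 := τ.ne_zero
  have hπ : (π : ℂ) ≠ 0 := by exact_mod_cast Real.pi_ne_zero
  simp only [Pi.sub_apply, Pi.smul_apply, D2_S, riemannZeta_two, smul_eq_mul] at h
  rw [zpow_neg, ← div_eq_mul_inv, div_eq_iff (by positivity)] at h
  rw [h]
  have hI := Complex.I_sq
  simp only [zpow_ofNat]
  field_simp
  linear_combination (-6 : ℂ) * hI
end

section

open UpperHalfPlane ModularForm ModularFormClass MatrixGroups EisensteinSeries ModularGroup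
open scoped CongruenceSubgroup Real Manifold

variable {E : Type*} [NormedAddCommGroup E] [InnerProductSpace ℝ E] [FiniteDimensional ℝ E]
variable {L : Submodule ℤ E} [DiscreteTopology L]

variable (L) in
theorem summable_thetaMoment (w : E) {τ : ℂ} (hτ : 0 < τ.im) (k : ℕ) :
    Summable fun x : L ↦ (⟪(x : E), w⟫ : ℂ) ^ k *
      Complex.exp (Real.pi * Complex.I * τ * ‖(x : E)‖ ^ 2) := by
  have h := ((summable_norm_theta_expansion L w hτ 1).of_norm.prod_symm.prod_factor k).mul_left
    (k.factorial : ℂ)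
  refine h.congr fun x ↦ ?_
  have := Nat.cast_ne_zero (R := ℂ).mpr k.factorial_ne_zero
  simp
  field_simp

theorem hasQJet_thetaMoment (heven : ∀ x ∈ L, ∃ k : ℤ, ⟪x, x⟫ = 2 * (k : ℝ))
    (hmin : ∀ x ∈ L, x ≠ 0 → 4 ≤ ⟪x, x⟫) {V : Finset E}
    (hV : ∀ x, x ∈ V ↔ x ∈ L ∧ ⟪x, x⟫ = 4) (w : E) (k : ℕ) :
    HasQJet (fun τ ↦ thetaMoment L w k τ) (0 ^ k) 0 (∑ x ∈ V, (⟪x, w⟫ : ℂ) ^ k) := by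
  have hN (x : L) : ∃ n : ℕ, ⟪(x : E), x⟫ = 2 * (n : ℝ) := by
    obtain ⟨m, hm⟩ := heven x x.2
    have h0 : (0 : ℝ) ≤ ⟪(x : E), x⟫ := real_inner_self_nonneg
    lift m to ℕ using by rw [hm] at h0; exact_mod_cast (by linarith : (0 : ℝ) ≤ m)
    exact ⟨m, by simpa using hm⟩
  choose N hN using hN
  refine ⟨.mk fun n ↦ ∑' x : N ⁻¹' {n}, (⟪(x : E), w⟫ : ℂ) ^ k, fun τ ↦ ?_, ?_, ?_, ?_⟩
  · have h := (summable_thetaMoment L w τ.im_pos k).hasSum.tsum_fiberwise N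
    refine h.congr_fun fun n ↦ ?_
    rw [PowerSeries.coeff_mk, ← tsum_mul_right]
    refine tsum_congr fun x ↦ ?_
    have hx : (‖(x : E)‖ : ℂ) ^ 2 = 2 * n := by
      have := hN x
      rw [real_inner_self_eq_norm_sq, x.2] at this
      exact_mod_cast this
    rw [hx, Function.Periodic.qParam, ← Complex.exp_nat_mul]
    congr 2
    push_cast
    ring
  · have h0 (x : N ⁻¹' {0}) : (x : E) = 0 := by
      rw [← inner_self_eq_zero (𝕜 := ℝ), hN x, x.2, Nat.cast_zero, mul_zero]
    have hz : N 0 = 0 := by simpa using hN 0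
    rw [PowerSeries.coeff_mk, tsum_eq_single ⟨0, hz⟩ fun x hx ↦
      (hx (Subtype.ext (Subtype.ext (h0 x)))).elim]
    simp
  · have : IsEmpty (N ⁻¹' {1}) := ⟨fun x ↦ by
      have h1 := hN x
      have h2 : (x : E) ≠ 0 := fun h ↦ by
        rw [x.2, h] at h1
        simp at h1
      have h3 := hmin x x.1.2 h2
      rw [h1, x.2] at h3
      norm_num at h3⟩
    rw [PowerSeries.coeff_mk, tsum_empty]
  · have hx (x : L) : N x = 2 ↔ (x : E) ∈ V := by
      rw [hV, hN x]
      refine ⟨fun h ↦ ⟨x.2, by rw [h]; norm_num⟩, fun h ↦ ?_⟩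
      exact_mod_cast (by linarith [h.2] : (N x : ℝ) = 2)
    let e : N ⁻¹' {2} ≃ V :=
      { toFun x := ⟨x, (hx x).mp x.2⟩
        invFun x := ⟨⟨x, ((hV x).mp x.2).1⟩, (hx _).mpr x.2⟩
        left_inv _ := rfl
        right_inv _ := rfl }
    rw [PowerSeries.coeff_mk, ← Finset.tsum_subtype, ← e.tsum_eq]
    rfl

variable [IsZLattice ℝ L] (hdual : ∀ y : E, y ∈ L ↔ ∀ x ∈ L, ∃ k : ℤ, ⟪x, y⟫ = (k : ℝ))
  (hm : Module.finrank ℝ E = 24) (w : E) (τ : ℍ)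
include hdual hm

theorem thetaMoment_apply_S (k : ℕ) :
    (2 * π * Complex.I) ^ k * thetaMoment L w k (S • τ : ℍ) / k.factorial = τ ^ 12 *
      ∑ p ∈ Finset.HasAntidiagonal.antidiagonal k,
        (if Even p.1 then (π * Complex.I * τ * ‖w‖ ^ 2) ^ (p.1 / 2) / (p.1 / 2).factorial else 0) *
        ((2 * π * Complex.I * τ) ^ p.2 * thetaMoment L w p.2 τ / p.2.factorial) := by
  have h := thetaMoment_neg_inv L hdual (m := 3) hm w τ.im_pos k
  have hS : ((S • τ : ℍ) : ℂ) = -1 / τ := by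
    rw [modular_S_smul, coe_mk, inv_neg, neg_div, one_div]
  rw [hS]
  exact h

theorem thetaMoment_zero_apply_S :
    thetaMoment L w 0 (S • τ : ℍ) = τ ^ 12 * thetaMoment L w 0 τ := by
  simpa using thetaMoment_apply_S hdual hm w τ 0

theorem thetaMoment_two_apply_S :
    thetaMoment L w 2 (S • τ : ℍ) = τ ^ 14 * thetaMoment L w 2 τ +
      ‖w‖ ^ 2 * (2 * π * Complex.I)⁻¹ * τ ^ 13 * thetaMoment L w 0 τ := by
  have h := thetaMoment_apply_S hdual hm w τ 2
  have hπ : (2 * π * Complex.I : ℂ) ≠ 0 := Complex.two_pi_I_ne_zero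
  refine mul_left_cancel₀ (pow_ne_zero 2 hπ) ?_
  generalize thetaMoment L w 2 (S • τ : ℍ) = X at h ⊢
  simp [Finset.Nat.antidiagonal_succ, Nat.factorial, Nat.even_iff] at h
  field_simp at h ⊢
  linear_combination h

theorem thetaMoment_four_apply_S :
    thetaMoment L w 4 (S • τ : ℍ) = τ ^ 16 * thetaMoment L w 4 τ +
      6 * ‖w‖ ^ 2 * (2 * π * Complex.I)⁻¹ * τ ^ 15 * thetaMoment L w 2 τ +
      3 * ‖w‖ ^ 4 * (2 * π * Complex.I)⁻¹ ^ 2 * τ ^ 14 * thetaMoment L w 0 τ := by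
  have h := thetaMoment_apply_S hdual hm w τ 4
  have hπ : (2 * π * Complex.I : ℂ) ≠ 0 := Complex.two_pi_I_ne_zero
  refine mul_left_cancel₀ (pow_ne_zero 4 hπ) ?_
  generalize thetaMoment L w 4 (S • τ : ℍ) = X at h ⊢
  simp [Finset.Nat.antidiagonal_succ, Nat.factorial, Nat.even_iff] at h
  field_simp at h ⊢
  linear_combination h / 8

theorem thetaMoment_six_apply_S :
    thetaMoment L w 6 (S • τ : ℍ) = τ ^ 18 * thetaMoment L w 6 τ +
      15 * ‖w‖ ^ 2 * (2 * π * Complex.I)⁻¹ * τ ^ 17 * thetaMoment L w 4 τ +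
      45 * ‖w‖ ^ 4 * (2 * π * Complex.I)⁻¹ ^ 2 * τ ^ 16 * thetaMoment L w 2 τ +
      15 * ‖w‖ ^ 6 * (2 * π * Complex.I)⁻¹ ^ 3 * τ ^ 15 * thetaMoment L w 0 τ := by
  have h := thetaMoment_apply_S hdual hm w τ 6
  have hπ : (2 * π * Complex.I : ℂ) ≠ 0 := Complex.two_pi_I_ne_zero
  refine mul_left_cancel₀ (pow_ne_zero 6 hπ) ?_
  generalize thetaMoment L w 6 (S • τ : ℍ) = X at h ⊢
  simp [Finset.Nat.antidiagonal_succ, Nat.factorial, Nat.even_iff] at h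
  field_simp at h ⊢
  linear_combination h / 1152
end

section

open UpperHalfPlane ModularForm ModularFormClass MatrixGroups EisensteinSeries ModularGroup
open scoped CongruenceSubgroup Real Manifold

variable {E : Type*} [NormedAddCommGroup E] [InnerProductSpace ℝ E] [FiniteDimensional ℝ E]
variable {L : Submodule ℤ E} [DiscreteTopology L] [IsZLattice ℝ L]
  (heven : ∀ x ∈ L, ∃ k : ℤ, ⟪x, x⟫ = 2 * (k : ℝ))
  (hdual : ∀ y : E, y ∈ L ↔ ∀ x ∈ L, ∃ k : ℤ, ⟪x, y⟫ = (k : ℝ))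
  (hmin : ∀ x ∈ L, x ≠ 0 → 4 ≤ ⟪x, x⟫)
  (hm : Module.finrank ℝ E = 24)
  {V : Finset E} (hV : ∀ x, x ∈ V ↔ x ∈ L ∧ ⟪x, x⟫ = 4) (w : E)

theorem E2_apply_S' (τ : ℍ) :
    E2 (S • τ) = τ ^ 2 * E2 τ + 12 * (2 * π * Complex.I)⁻¹ * τ := by
  rw [E2_apply_S]
  ring

theorem E₄_apply_S (τ : ℍ) : E₄ (S • τ) = τ ^ 4 * E₄ τ := modularForm_apply_S (k := 4) E₄ τ

theorem E₆_apply_S (τ : ℍ) : E₆ (S • τ) = τ ^ 6 * E₆ τ := modularForm_apply_S (k := 6) E₆ τ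

include heven hdual hmin hm hV

theorem sum_inner_pow_zero : (∑ x ∈ V, (⟪x, w⟫ : ℂ) ^ 0) = 196560 := by
  have h0 := hasQJet_thetaMoment heven hmin hV w 0
  have h := h0.sub (((hasQJet_E₄.mul (hasQJet_E₄.mul hasQJet_E₄)).smul (7 / 12)).add
    ((hasQJet_E₆.mul hasQJet_E₆).smul (5 / 12)))
  have := h.eq_zero (k := 12) (by norm_num) (fun τ ↦ ?_) (by norm_num) (by norm_num)
  · linear_combination this
  · simp only [Pi.sub_apply, Pi.add_apply, Pi.mul_apply, Pi.smul_apply, smul_eq_mul, E₄_apply_S,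
      E₆_apply_S, thetaMoment_zero_apply_S hdual hm w τ]
    ring

theorem sum_inner_pow_two : ∑ x ∈ V, (⟪x, w⟫ : ℂ) ^ 2 = 32760 * ‖w‖ ^ 2 := by
  have h0 := hasQJet_thetaMoment heven hmin hV w 0
  have h2 := hasQJet_thetaMoment heven hmin hV w 2
  rw [sum_inner_pow_zero heven hdual hmin hm hV] at h0
  have h := (h2.sub ((hasQJet_E2.mul h0).smul (‖w‖ ^ 2 / 12))).add
    ((hasQJet_E₄.mul (hasQJet_E₄.mul hasQJet_E₆)).smul (‖w‖ ^ 2 / 12))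
  have := h.eq_zero (k := 14) (by norm_num) (fun τ ↦ ?_) (by ring) (by ring)
  · linear_combination this
  · simp only [Pi.sub_apply, Pi.add_apply, Pi.mul_apply, Pi.smul_apply, smul_eq_mul, E₄_apply_S,
      E₆_apply_S, E2_apply_S', thetaMoment_zero_apply_S hdual hm w τ,
      thetaMoment_two_apply_S hdual hm w τ]
    ring

theorem sum_inner_pow_four : ∑ x ∈ V, (⟪x, w⟫ : ℂ) ^ 4 = 15120 * ‖w‖ ^ 4 := by
  have h0 := hasQJet_thetaMoment heven hmin hV w 0
  have h2 := hasQJet_thetaMoment heven hmin hV w 2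
  have h4 := hasQJet_thetaMoment heven hmin hV w 4
  rw [sum_inner_pow_zero heven hdual hmin hm hV] at h0
  rw [sum_inner_pow_two heven hdual hmin hm hV] at h2
  have h := ((h4.sub ((hasQJet_E2.mul h2).smul (‖w‖ ^ 2 / 2))).add
    ((hasQJet_E2.mul (hasQJet_E2.mul h0)).smul (‖w‖ ^ 4 / 48))).sub
    (((hasQJet_E₄.mul (hasQJet_E₄.mul (hasQJet_E₄.mul hasQJet_E₄))).smul (5 * ‖w‖ ^ 4 / 576)).add
      ((hasQJet_E₄.mul (hasQJet_E₆.mul hasQJet_E₆)).smul (7 * ‖w‖ ^ 4 / 576)))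
  have := h.eq_zero (k := 16) (by norm_num) (fun τ ↦ ?_) (by ring) (by ring)
  · linear_combination this
  · simp only [Pi.sub_apply, Pi.add_apply, Pi.mul_apply, Pi.smul_apply, smul_eq_mul, E₄_apply_S,
      E₆_apply_S, E2_apply_S', thetaMoment_zero_apply_S hdual hm w τ,
      thetaMoment_two_apply_S hdual hm w τ, thetaMoment_four_apply_S hdual hm w τ]
    ring

theorem sum_inner_pow_six : ∑ x ∈ V, (⟪x, w⟫ : ℂ) ^ 6 = 10800 * ‖w‖ ^ 6 := by
  have h0 := hasQJet_thetaMoment heven hmin hV w 0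
  have h2 := hasQJet_thetaMoment heven hmin hV w 2
  have h4 := hasQJet_thetaMoment heven hmin hV w 4
  have h6 := hasQJet_thetaMoment heven hmin hV w 6
  rw [sum_inner_pow_zero heven hdual hmin hm hV] at h0
  rw [sum_inner_pow_two heven hdual hmin hm hV] at h2
  rw [sum_inner_pow_four heven hdual hmin hm hV] at h4
  have h := (((h6.sub ((hasQJet_E2.mul h4).smul (5 * ‖w‖ ^ 2 / 4))).add
    ((hasQJet_E2.mul (hasQJet_E2.mul h2)).smul (5 * ‖w‖ ^ 4 / 16))).sub
    ((hasQJet_E2.mul (hasQJet_E2.mul (hasQJet_E2.mul h0))).smul (5 * ‖w‖ ^ 6 / 576))).add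
    (((hasQJet_E₄.mul (hasQJet_E₄.mul (hasQJet_E₄.mul hasQJet_E₆))).smul
        (25 * ‖w‖ ^ 6 / 3456)).add
      ((hasQJet_E₆.mul (hasQJet_E₆.mul hasQJet_E₆)).smul (5 * ‖w‖ ^ 6 / 3456)))
  have := h.eq_zero (k := 18) (by norm_num) (fun τ ↦ ?_) (by ring) (by ring)
  · linear_combination this
  · simp only [Pi.sub_apply, Pi.add_apply, Pi.mul_apply, Pi.smul_apply, smul_eq_mul, E₄_apply_S,
      E₆_apply_S, E2_apply_S', thetaMoment_zero_apply_S hdual hm w τ,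
      thetaMoment_two_apply_S hdual hm w τ, thetaMoment_four_apply_S hdual hm w τ,
      thetaMoment_six_apply_S hdual hm w τ]
    ring
end

section
variable {E : Type*} [NormedAddCommGroup E] [InnerProductSpace ℝ E] [FiniteDimensional ℝ E]
variable {L : Submodule ℤ E}

theorem exists_finset_mem_iff_inner_self_eq [DiscreteTopology L] (r : ℝ) :
    ∃ V : Finset E, ∀ x, x ∈ V ↔ x ∈ L ∧ ⟪x, x⟫ = r := by
  have : {x | x ∈ L ∧ ⟪x, x⟫ = r}.Finite := by
    have : DiscreteTopology L.toAddSubgroup := ‹_›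
    refine (Metric.finite_isBounded_inter_isClosed DiscreteTopology.isDiscrete (K := closedBall (0 : E) √r)
      (s := (L.toAddSubgroup : Set E)) isBounded_closedBall
      (AddSubgroup.isClosed_of_discrete (H := L.toAddSubgroup))).subset fun x hx ↦ ⟨?_, hx.1⟩
    rw [mem_closedBall_zero_iff, ← hx.2, real_inner_self_eq_norm_sq, Real.sqrt_sq (norm_nonneg _)]
  exact ⟨this.toFinset, by simp⟩

omit [FiniteDimensional ℝ E] in
theorem inner_polynomial_eq_indicator
    (hint : ∀ x ∈ L, ∀ y ∈ L, ∃ k : ℤ, ⟪x, y⟫ = (k : ℝ))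
    (hmin : ∀ x ∈ L, x ≠ 0 → 4 ≤ ⟪x, x⟫)
    {A B : E} (hA : A ∈ L) (hB : B ∈ L) (hAA : ⟪A, A⟫ = 4) (hBB : ⟪B, B⟫ = 4)
    (hAB : ⟪A, B⟫ = -1) {x : E} (hx : x ∈ L) (hxx : ⟪x, x⟫ = 4) :
    ⟪x, A⟫ * (⟪x, A⟫ ^ 2 - 1) * (1 - ⟪x, B⟫ ^ 2) * (⟪x, A⟫ + ⟪x, B⟫) =
      12 * ((if ⟪x, A⟫ = 2 ∧ ⟪x, B⟫ = 0 then 1 else 0) +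
        (if ⟪x, A⟫ = -2 ∧ ⟪x, B⟫ = 0 then 1 else 0)) := by
  have hbound {C : E} (hC : C ∈ L) (hCC : ⟪C, C⟫ = 4) : x = C ∨ ⟪x, C⟫ ≤ 2 := by
    by_contra! h
    have h1 := hmin _ (L.sub_mem hx hC) (sub_ne_zero.mpr h.1)
    rw [real_inner_sub_sub_self, hxx, hCC] at h1
    linarith [h.2]
  have hBA : ⟪B, A⟫ = -1 := by rw [real_inner_comm, hAB]
  have hsum (C : E) (hC : C ∈ L) (hCC : ⟪C, C⟫ = 6) (hxC : ⟪x, C⟫ = 4) : False := by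
    have h1 : ⟪x - C, x - C⟫ = 2 := by
      rw [real_inner_sub_sub_self, hxx, hCC, hxC]
      norm_num
    have h2 := hmin _ (L.sub_mem hx hC) fun h ↦ by simp [h] at h1
    linarith
  have h1 := hbound hA hAA
  have h2 := hbound (L.neg_mem hA) (by simpa using hAA)
  have h3 := hbound hB hBB
  have h4 := hbound (L.neg_mem hB) (by simpa using hBB)
  have h5 := hsum (A + B) (L.add_mem hA hB) (by
    rw [real_inner_add_add_self, hAA, hBB, hAB]; norm_num)
  have h6 := hsum (-(A + B)) (L.neg_mem (L.add_mem hA hB)) (by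
    rw [inner_neg_neg, real_inner_add_add_self, hAA, hBB, hAB]; norm_num)
  rw [inner_neg_right, inner_add_right] at h6
  rw [inner_add_right] at h5
  rw [inner_neg_right] at h2 h4
  rcases h1 with rfl | h1
  · norm_num [hAA, hAB]
  rcases h2 with rfl | h2
  · norm_num [hAA, hAB]
  rcases h3 with rfl | h3
  · norm_num [hBB, hBA]
  rcases h4 with rfl | h4
  · norm_num [hBB, hBA]
  obtain ⟨i, hi⟩ := hint x hx A hA
  obtain ⟨j, hj⟩ := hint x hx B hB
  rw [hi] at h1 h2
  rw [hj] at h3 h4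
  rw [hi, hj] at h5 h6 ⊢
  norm_cast at h1 h2 h3 h4 h5 h6 ⊢
  have h2' : -2 ≤ i := by omega
  have h4' : -2 ≤ j := by omega
  interval_cases i <;> interval_cases j <;> simp_all

variable [DiscreteTopology L] [IsZLattice ℝ L]

theorem ncard_inner_eq_two_inner_eq_zero (heven : ∀ x ∈ L, ∃ k : ℤ, ⟪x, x⟫ = 2 * (k : ℝ))
    (hdual : ∀ y : E, y ∈ L ↔ ∀ x ∈ L, ∃ k : ℤ, ⟪x, y⟫ = (k : ℝ))
    (hmin : ∀ x ∈ L, x ≠ 0 → 4 ≤ ⟪x, x⟫) (hm : Module.finrank ℝ E = 24)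
    {A B : E} (hA : A ∈ L) (hB : B ∈ L) (hAA : ⟪A, A⟫ = 4) (hBB : ⟪B, B⟫ = 4)
    (hAB : ⟪A, B⟫ = -1) :
    {x : E | x ∈ L ∧ ⟪x, x⟫ = 4 ∧ ⟪x, A⟫ = 2 ∧ ⟪x, B⟫ = 0}.ncard = 2025 := by
  obtain ⟨V, hV⟩ := exists_finset_mem_iff_inner_self_eq (L := L) 4
  have hnorm (s t : ℝ) : ‖s • A + t • B‖ ^ 2 = 4 * s ^ 2 - 2 * s * t + 4 * t ^ 2 := by
    rw [norm_add_sq_real, inner_smul_left, inner_smul_right, norm_smul, norm_smul, mul_pow, mul_pow,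
      ← real_inner_self_eq_norm_sq A, ← real_inner_self_eq_norm_sq B, hAA, hBB, hAB]
    simp
    ring
  have hin (s t : ℝ) (x : E) : ⟪x, s • A + t • B⟫ = s * ⟪x, A⟫ + t * ⟪x, B⟫ := by
    rw [inner_add_right, inner_smul_right, inner_smul_right]
  have h2 (s t : ℝ) : ∑ x ∈ V, (s * ⟪x, A⟫ + t * ⟪x, B⟫) ^ 2 =
      32760 * (4 * s ^ 2 - 2 * s * t + 4 * t ^ 2) := by
    rw [← hnorm]
    simp only [← hin]
    exact_mod_cast sum_inner_pow_two heven hdual hmin hm hV (s • A + t • B)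
  have h4 (s t : ℝ) : ∑ x ∈ V, (s * ⟪x, A⟫ + t * ⟪x, B⟫) ^ 4 =
      15120 * (4 * s ^ 2 - 2 * s * t + 4 * t ^ 2) ^ 2 := by
    rw [← hnorm, ← pow_mul]
    simp only [← hin]
    exact_mod_cast sum_inner_pow_four heven hdual hmin hm hV (s • A + t • B)
  have h6 (s t : ℝ) : ∑ x ∈ V, (s * ⟪x, A⟫ + t * ⟪x, B⟫) ^ 6 =
      10800 * (4 * s ^ 2 - 2 * s * t + 4 * t ^ 2) ^ 3 := by
    rw [← hnorm, ← pow_mul]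
    simp only [← hin]
    exact_mod_cast sum_inner_pow_six heven hdual hmin hm hV (s • A + t • B)
  have htotal : ∑ x ∈ V, ⟪x, A⟫ * (⟪x, A⟫ ^ 2 - 1) * (1 - ⟪x, B⟫ ^ 2) * (⟪x, A⟫ + ⟪x, B⟫) =
      48600 := by
    have hpoly (i j : ℝ) : i * (i ^ 2 - 1) * (1 - j ^ 2) * (i + j) =
        5 / 24 * (1 * i + 0 * j) ^ 6 + -17 / 120 * (0 * i + 1 * j) ^ 6 +
        -23 / 360 * (1 * i + 1 * j) ^ 6 + 11 / 360 * (1 * i + -1 * j) ^ 6 +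
        -1 / 360 * (2 * i + -1 * j) ^ 6 + 1 / 360 * (1 * i + 2 * j) ^ 6 +
        5 / 6 * (1 * i + 0 * j) ^ 4 + -1 / 6 * (0 * i + 1 * j) ^ 4 +
        5 / 24 * (1 * i + 1 * j) ^ 4 + -1 / 24 * (1 * i + -1 * j) ^ 4 +
        -1 / 2 * (1 * i + 0 * j) ^ 2 + 1 / 2 * (0 * i + 1 * j) ^ 2 +
        -1 / 2 * (1 * i + 1 * j) ^ 2 := by ring
    simp only [hpoly, Finset.sum_add_distrib, ← Finset.mul_sum, h2, h4, h6]
    norm_num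
  have hcount (a : ℝ) : {x : E | x ∈ L ∧ ⟪x, x⟫ = 4 ∧ ⟪x, A⟫ = a ∧ ⟪x, B⟫ = 0} =
      V.filter fun x ↦ ⟪x, A⟫ = a ∧ ⟪x, B⟫ = 0 := by
    ext x
    simp [hV, and_assoc]
  have hneg : (V.filter fun x ↦ ⟪x, A⟫ = -2 ∧ ⟪x, B⟫ = 0).card =
      (V.filter fun x ↦ ⟪x, A⟫ = 2 ∧ ⟪x, B⟫ = 0).card := by
    refine Finset.card_nbij' (-·) (-·) ?_ ?_ (fun _ _ ↦ neg_neg _) (fun _ _ ↦ neg_neg _) <;>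
    · intro x
      simp only [Finset.coe_filter, Set.mem_ofPred_eq, hV, inner_neg_left, inner_neg_right, neg_mem_iff,
        neg_eq_iff_eq_neg, neg_neg, neg_zero]
      exact id
  have hint (x : E) (hx : x ∈ L) (y : E) (hy : y ∈ L) : ∃ k : ℤ, ⟪x, y⟫ = (k : ℝ) :=
    (hdual y).mp hy x hx
  rw [Finset.sum_congr rfl fun x hx ↦ inner_polynomial_eq_indicator hint hmin
    hA hB hAA hBB hAB ((hV x).mp hx).1 ((hV x).mp hx).2, ← Finset.mul_sum, Finset.sum_add_distrib, Finset.sum_boole,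
    Finset.sum_boole, hneg] at htotal
  rw [hcount, Set.ncard_coe_finset]
  exact_mod_cast (by linarith : ((V.filter fun x ↦ ⟪x, A⟫ = 2 ∧ ⟪x, B⟫ = 0).card : ℝ) = 2025)
end

/-- in the Leech lattice, for norm-4 vectors `A`, `B` with `⟨A,B⟩ = -1`, the sets
`X₂⁰ = {x ∈ Λ : ⟨x,x⟩ = 4, ⟨x,A⟩ = 2, ⟨x,B⟩ = 0}` and
`X₂⁰' = {x ∈ Λ : ⟨x,x⟩ = 4, ⟨x,A⟩ = 0, ⟨x,B⟩ = -2}` each have exactly 2025 elements. -/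
theorem statement12
    (L : Submodule ℤ (EuclideanSpace ℝ (Fin 24)))
    [DiscreteTopology L] [IsZLattice ℝ L]
    (heven : ∀ x ∈ L, ∃ k : ℤ, ⟪x, x⟫ = 2 * (k : ℝ))
    (hdual : ∀ y : EuclideanSpace ℝ (Fin 24), y ∈ L ↔ ∀ x ∈ L, ∃ k : ℤ, ⟪x, y⟫ = (k : ℝ))
    (hmin : ∀ x ∈ L, x ≠ 0 → 4 ≤ ⟪x, x⟫)
    (A B : EuclideanSpace ℝ (Fin 24)) (hA : A ∈ L) (hB : B ∈ L)
    (hAA : ⟪A, A⟫ = 4) (hBB : ⟪B, B⟫ = 4) (hAB : ⟪A, B⟫ = -1)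
    :
    {x : EuclideanSpace ℝ (Fin 24) |
        x ∈ L ∧ ⟪x, x⟫ = 4 ∧ ⟪x, A⟫ = 2 ∧ ⟪x, B⟫ = 0}.ncard = 2025 ∧
    {x : EuclideanSpace ℝ (Fin 24) |
        x ∈ L ∧ ⟪x, x⟫ = 4 ∧ ⟪x, A⟫ = 0 ∧ ⟪x, B⟫ = -2}.ncard = 2025 := by
  have hm : Module.finrank ℝ (EuclideanSpace ℝ (Fin 24)) = 24 := finrank_euclideanSpace_fin
  refine ⟨ncard_inner_eq_two_inner_eq_zero heven hdual hmin hm hA hB hAA hBB hAB, ?_⟩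
  have h := ncard_inner_eq_two_inner_eq_zero heven hdual hmin hm hB hA hBB hAA
    (by rw [real_inner_comm, hAB])
  rw [← h, ← Set.ncard_image_of_injective _ neg_injective, Set.image_neg_eq_neg]
  congr 1
  ext x
  simp [neg_eq_iff_eq_neg, and_comm]
end

section
/- Let Λ be an even unimodular lattice in ℝ^24 of minimal norm 4 (the Leech lattice). Then the shell of norm 4, { x ∈ Λ : ⟨x,x⟩ = 4 }, has exactly 196560 elements, and the shell of norm 6, { x ∈ Λ : ⟨x,x⟩ = 6 }, has exactly 16773120 elements. -/
open MeasureTheory Metric MvPolynomial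
open scoped RealInnerProductSpace Classical

section PoissonSummation

open UnitAddTorus TopologicalSpace

variable {ι : Type*}

/-- A point with integer coordinates, viewed in the real coordinate space. -/
def intPoint (n : ι → ℤ) : ι → ℝ := fun i => n i

/-- The half-open unit cube, the standard fundamental domain of the integer points. -/
def unitCube (ι : Type*) : Set (ι → ℝ) := {x | ∀ i, x i ∈ Set.Ioc (0 : ℝ) (0 + 1)}

lemma unitCube_eq_pi : unitCube ι = Set.univ.pi fun _ => Set.Ioc (0 : ℝ) (0 + 1) := by
  ext; simp [unitCube]

/-- The projection of the coordinate space onto the torus. -/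
def torusProj (ι : Type*) : C(ι → ℝ, UnitAddTorus ι) where
  toFun x i := x i
  continuous_toFun := by fun_prop

lemma isQuotientMap_torusProj : Topology.IsQuotientMap (torusProj ι) :=
  (IsOpenQuotientMap.piMap (f := fun (_ : ι) (x : ℝ) => (x : UnitAddCircle))
    fun _ => QuotientAddGroup.isOpenQuotientMap_mk).isQuotientMap

lemma torusProj_eq_iff {x y : ι → ℝ} :
    torusProj ι x = torusProj ι y ↔ ∃ n : ι → ℤ, y = x + intPoint n := by
  constructor
  · intro h
    have (i : ι) : ∃ n : ℤ, y i = x i + n := by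
      have h0 : ((y i - x i : ℝ) : UnitAddCircle) = 0 := by
        rw [AddCircle.coe_sub, sub_eq_zero]
        exact (congrFun h i).symm
      obtain ⟨n, hn⟩ := (AddCircle.coe_eq_zero_iff (1 : ℝ)).1 h0
      exact ⟨n, by simp at hn; linarith⟩
    choose n hn using this
    exact ⟨n, funext hn⟩
  · rintro ⟨n, rfl⟩
    funext i
    simp [torusProj, intPoint]

variable [Fintype ι]

lemma measurableSet_unitCube : MeasurableSet (unitCube ι) := by
  rw [unitCube_eq_pi]
  exact MeasurableSet.univ_pi fun _ => measurableSet_Ioc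

lemma hasSum_setIntegral_unitCube {E : Type*} [NormedAddCommGroup E] [NormedSpace ℝ E]
    {g : (ι → ℝ) → E} (hg : Integrable g) :
    HasSum (fun n : ι → ℤ => ∫ x in unitCube ι, g (x + intPoint n)) (∫ x, g x) := by
  let s : (ι → ℤ) → Set (ι → ℝ) := fun n => (fun x => x - intPoint n) ⁻¹' unitCube ι
  have hs : ∀ n, MeasurableSet (s n) := fun n =>
    (measurable_id.sub_const _) measurableSet_unitCube
  have hcover : ⋃ n, s n = Set.univ := by
    refine Set.eq_univ_of_forall fun x => Set.mem_iUnion.2 ?_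
    choose n hn using fun i => (existsUnique_sub_zsmul_mem_Ioc one_pos (x i) (0 : ℝ)).exists
    exact ⟨n, fun i => by simpa [intPoint] using hn i⟩
  have hdisj : Pairwise (Function.onFun Disjoint s) := by
    intro m n hmn
    refine Set.disjoint_left.2 fun x hm hn => hmn ?_
    funext i
    refine (existsUnique_sub_zsmul_mem_Ioc one_pos (x i) (0 : ℝ)).unique ?_ ?_
    · simpa [intPoint] using hm i
    · simpa [intPoint] using hn i
  have h := hasSum_integral_iUnion hs hdisj hg.integrableOn
  rw [hcover, setIntegral_univ] at h
  convert h using 2 with n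
  have := (measurePreserving_sub_right (volume : Measure (ι → ℝ))
    (intPoint n)).setIntegral_preimage_emb (measurableEmbedding_subRight (intPoint n)) (fun x => g (x + intPoint n)) (unitCube ι)
  simpa using this.symm

/-- The character of the coordinate space attached to an integer frequency vector. -/
noncomputable def planeWave (m : ι → ℤ) (x : ι → ℝ) : ℂ :=
  Complex.exp (-(2 * Real.pi * Complex.I * ∑ i, (m i : ℂ) * x i))

lemma mFourier_neg_torusProj (m : ι → ℤ) (x : ι → ℝ) :
    mFourier (-m) (torusProj ι x) = planeWave m x := by
  simp only [mFourier, torusProj, ContinuousMap.coe_mk, fourier_coe_apply, planeWave,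
    ← Complex.exp_sum]
  congr 1
  rw [Finset.mul_sum, ← Finset.sum_neg_distrib]
  refine Finset.sum_congr rfl fun i _ => ?_
  simp
  ring

lemma norm_planeWave (m : ι → ℤ) (x : ι → ℝ) : ‖planeWave m x‖ = 1 := by
  rw [planeWave, Complex.norm_exp]
  simp [Complex.mul_re]

lemma continuous_planeWave (m : ι → ℤ) : Continuous (planeWave m) := by
  unfold planeWave; fun_prop

lemma planeWave_add_intPoint (m n : ι → ℤ) (x : ι → ℝ) :
    planeWave m (x + intPoint n) = planeWave m x := by
  rw [← mFourier_neg_torusProj, ← mFourier_neg_torusProj,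
    ← torusProj_eq_iff.2 ⟨n, (rfl : x + intPoint n = x + intPoint n)⟩]

/-- **Poisson summation** in several variables. -/
theorem tsum_intPoint_eq_tsum_integral_planeWave {g : C(ι → ℝ, ℂ)} (hg : Integrable g)
    (hloc : ∀ K : Compacts (ι → ℝ), Summable fun n : ι → ℤ =>
      ‖(g.comp (ContinuousMap.addRight (intPoint n))).restrict K‖)
    (hsum : Summable fun m : ι → ℤ => ∫ x, planeWave m x * g x) :
    ∑' n : ι → ℤ, g (intPoint n) = ∑' m : ι → ℤ, ∫ x, planeWave m x * g x := by
  have hsummable := ContinuousMap.summable_of_locally_summable_norm hloc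
  let G : C(ι → ℝ, ℂ) := ∑' n : ι → ℤ, g.comp (ContinuousMap.addRight (intPoint n))
  have hG (x : ι → ℝ) : G x = ∑' n : ι → ℤ, g (x + intPoint n) :=
    (ContinuousMap.tsum_apply hsummable x).symm
  have hper : Function.FactorsThrough G (torusProj ι) := by
    intro x y hxy
    obtain ⟨k, rfl⟩ := torusProj_eq_iff.1 hxy
    rw [hG, hG, ← (Equiv.addLeft k).tsum_eq]
    refine tsum_congr fun n => ?_
    congr 1
    funext i
    simp [intPoint, add_assoc]
  let F : C(UnitAddTorus ι, ℂ) := isQuotientMap_torusProj.lift G hper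
  have hF (x : ι → ℝ) : F (torusProj ι x) = G x :=
    congrFun (congrArg DFunLike.coe (isQuotientMap_torusProj.lift_comp G hper)) x
  have hcoeff (m : ι → ℤ) : mFourierCoeff F m = ∫ x, planeWave m x * g x := by
    have hwave : Integrable fun x => planeWave m x * g x :=
      hg.bdd_mul (continuous_planeWave m).aestronglyMeasurable
        (Filter.Eventually.of_forall fun x => (norm_planeWave m x).le)
    rw [mFourierCoeff_eq_integral F m 0]
    have h1 : ∀ x, mFourier (-m) (fun i => (x i : UnitAddCircle)) •
        F (fun i => (x i : UnitAddCircle)) = ∑' n : ι → ℤ, planeWave m (x + intPoint n) * g (x + intPoint n) := by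
      intro x
      have := mFourier_neg_torusProj m x
      have h2 := hF x
      simp only [torusProj, ContinuousMap.coe_mk] at this h2
      rw [this, h2, hG, smul_eq_mul, ← tsum_mul_left]
      simp_rw [planeWave_add_intPoint]
    simp_rw [h1]
    have hs := hasSum_setIntegral_unitCube hwave
    have hs' := hasSum_setIntegral_unitCube hwave.norm
    refine ((hasSum_integral_of_summable_integral_norm (μ := volume.restrict (unitCube ι))
      (fun n => ?_) hs'.summable).unique hs)
    exact (hwave.comp_add_right (intPoint n)).integrableOn
  have hsum' : Summable (mFourierCoeff F) := by simpa only [funext hcoeff] using hsum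
  have h := (hasSum_mFourier_series_apply_of_summable hsum' (torusProj ι 0)).tsum_eq
  rw [hF, hG] at h
  simp only [zero_add] at h
  rw [← h]
  refine tsum_congr fun m => ?_
  rw [hcoeff]
  have : mFourier m (torusProj ι 0) = 1 := by
    rw [← neg_neg m, mFourier_neg_torusProj]; simp [planeWave]
  rw [this, smul_eq_mul, mul_one]

end PoissonSummation

section LatticeGaussianSum

open TopologicalSpace

variable {E : Type*} [NormedAddCommGroup E] [InnerProductSpace ℝ E] [FiniteDimensional ℝ E]
  (L : Submodule ℤ E) [DiscreteTopology L]

lemma summable_exp_neg_mul_norm_sq {a : ℝ} (ha : 0 < a) :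
    Summable fun x : L => Real.exp (-a * ‖x‖ ^ 2) := by
  set k := Module.finrank ℤ L + 1 with hk
  have h := (ZLattice.summable_norm_pow_inv L (2 * k) (by omega)).mul_left (k.factorial / a ^ k)
  refine Summable.of_norm_bounded_eventually h ?_
  filter_upwards [(Set.finite_singleton (0 : L)).compl_mem_cofinite] with x hx
  have hx0 : 0 < ‖x‖ := norm_pos_iff.2 hx
  have h1 := Real.pow_div_factorial_le_exp (a * ‖x‖ ^ 2) (by positivity) k
  rw [Real.norm_eq_abs, Real.abs_exp, neg_mul, Real.exp_neg]
  refine (inv_anti₀ (by positivity) h1).trans_eq ?_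
  rw [pow_mul, inv_pow, mul_pow, inv_pow, inv_div]
  field_simp

lemma summable_cexp_neg_mul_norm_sq {t : ℂ} (ht : 0 < t.re) :
    Summable fun x : L => Complex.exp (-(Real.pi * t) * ‖x‖ ^ 2) := by
  refine Summable.of_norm ((summable_exp_neg_mul_norm_sq L (mul_pos Real.pi_pos ht)).congr
    fun x => ?_)
  rw [Complex.norm_exp, ← Complex.ofReal_pow, Complex.re_mul_ofReal]
  simp

variable [IsZLattice ℝ L]

lemma exists_tsum_gaussian_eq_of_selfDual
    (hdual : ∀ y : E, y ∈ L ↔ ∀ x ∈ L, ∃ k : ℤ, ⟪x, y⟫ = (k : ℝ)) :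
    ∃ c : ℂ, ∀ t : ℂ, 0 < t.re →
      ∑' x : L, Complex.exp (-(Real.pi * t) * ‖x‖ ^ 2) =
        c * (1 / t) ^ (Module.finrank ℝ E / 2 : ℂ) *
          ∑' x : L, Complex.exp (-(Real.pi * (1 / t)) * ‖x‖ ^ 2) := by
  let _ : MeasurableSpace E := borel E
  have : BorelSpace E := ⟨rfl⟩
  have : Module.Finite ℤ L := ZLattice.module_finite ℝ L
  have : Module.Free ℤ L := ZLattice.module_free ℝ L
  let b := Module.Free.chooseBasis ℤ L
  let B := b.ofZLatticeBasis ℝ L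
  let A := B.equivFun.symm.toContinuousLinearEquiv
  have hA (v) : A v = ∑ i, v i • (b i : E) := by
    simp [A, B, Module.Basis.equivFun_symm_apply]
  have hAint (n) : A (intPoint n) = (b.equivFun.symm n : L) := by
    rw [hA, Module.Basis.equivFun_symm_apply]
    simp [intPoint, Int.cast_smul_eq_zsmul]
  obtain ⟨c, hc⟩ : ∃ c : NNReal, Measure.map A volume = c • (volume : Measure E) := by
    have : (Measure.map A volume).IsAddHaarMeasure := A.isAddHaarMeasure_map volume
    exact ⟨_, Measure.isAddLeftInvariant_eq_smul _ _⟩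
  have integral_comp_A (f : E → ℂ) : ∫ v, f (A v) = (c : ℂ) * ∫ x, f x := by
    have := integral_map_equiv (μ := volume) A.toHomeomorph.toMeasurableEquiv f
    simp only [Homeomorph.toMeasurableEquiv_coe, ContinuousLinearEquiv.coe_toHomeomorph] at this
    rw [← this, hc, integral_smul_nnreal_measure]
    simp [NNReal.smul_def]
  have hw (m : Module.Free.ChooseBasisIndex ℤ L → ℤ) :
      ∃ w : L, ∀ v, ⟪(w : E), A v⟫ = ∑ i, (m i : ℝ) * v i := by
    let φ : E →L[ℝ] ℝ := LinearMap.toContinuousLinearMap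
      ((∑ i, (m i : ℝ) • LinearMap.proj i) ∘ₗ B.equivFun.toLinearMap)
    have h1 (v) : ⟪(InnerProductSpace.toDual ℝ E).symm φ, A v⟫ = ∑ i, (m i : ℝ) * v i := by
      rw [InnerProductSpace.toDual_symm_apply]
      change (∑ i, (m i : ℝ) • LinearMap.proj i :
        (Module.Free.ChooseBasisIndex ℤ L → ℝ) →ₗ[ℝ] ℝ) (B.equivFun (B.equivFun.symm v)) = _
      rw [LinearEquiv.apply_symm_apply]
      simp
    refine ⟨⟨_, (hdual _).2 fun x hx => ?_⟩, h1⟩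
    obtain ⟨n, hn⟩ := b.equivFun.symm.surjective ⟨x, hx⟩
    have hx' : x = A (intPoint n) := by rw [hAint, hn]
    refine ⟨∑ i, m i * n i, ?_⟩
    rw [hx', real_inner_comm, h1]
    simp [intPoint]
  choose w hw using hw
  have hwbij : Function.Bijective w := by
    constructor
    · intro m m' h
      funext i
      have h1 := hw m (Pi.single i 1)
      have h2 := hw m' (Pi.single i 1)
      rw [h, h2] at h1
      simpa [Pi.single_apply] using h1.symm
    · intro y
      choose m hm using fun i => (hdual y).1 y.2 (b i) (b i).2
      refine ⟨m, Subtype.ext (ext_inner_right ℝ fun x => ?_)⟩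
      obtain ⟨v, rfl⟩ := A.surjective x
      rw [hw, hA, inner_sum]
      refine Finset.sum_congr rfl fun i _ => ?_
      rw [inner_smul_right, real_inner_comm, hm, mul_comm]
  refine ⟨c, fun t ht => ?_⟩
  have ht0 : t ≠ 0 := by rintro rfl; simp at ht
  have hπt : 0 < (Real.pi * t : ℂ).re := by simpa [Complex.mul_re] using mul_pos Real.pi_pos ht
  have ht' : 0 < (1 / t).re := by
    rw [one_div, Complex.inv_re]
    exact div_pos ht (Complex.normSq_pos.2 ht0)
  let g : C(Module.Free.ChooseBasisIndex ℤ L → ℝ, ℂ) :=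
    ⟨fun v => Complex.exp (-(Real.pi * t) * ‖A v‖ ^ 2), by fun_prop⟩
  have hnorm (v) : ‖g v‖ = Real.exp (-(Real.pi * t.re) * ‖A v‖ ^ 2) := by
    change ‖Complex.exp _‖ = _
    rw [Complex.norm_exp, ← Complex.ofReal_pow, Complex.re_mul_ofReal]
    simp
  have hcoeff (m) : ∫ v, planeWave m v * g v =
      c * (1 / t) ^ (Module.finrank ℝ E / 2 : ℂ) *
        Complex.exp (-(Real.pi * (1 / t)) * ‖w m‖ ^ 2) := by
    have h1 := GaussianFourier.integral_cexp_neg_mul_sq_norm_add hπt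
      (-(2 * Real.pi * Complex.I)) (w m : E)
    let f : E → ℂ := fun x =>
      Complex.exp (-(Real.pi * t) * ‖x‖ ^ 2 + (-(2 * Real.pi * Complex.I)) * ⟪(w m : E), x⟫)
    have h2 (v) : planeWave m v * g v = f (A v) := by
      change Complex.exp _ * Complex.exp _ = Complex.exp _
      rw [← Complex.exp_add, hw]
      congr 1
      push_cast
      ring
    rw [integral_congr_ae (Filter.Eventually.of_forall h2), integral_comp_A f, h1, ← mul_assoc,
      show (Real.pi : ℂ) / (Real.pi * t) = 1 / t by field_simp]
    congr 2
    field_simp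
    rw [Complex.I_sq, Submodule.coe_norm]
    ring
  have hpois := tsum_intPoint_eq_tsum_integral_planeWave (g := g) ?_ ?_ ?_
  · simp_rw [hcoeff] at hpois
    have hw_tsum := (Equiv.ofBijective w hwbij).tsum_eq
      (fun x : L => Complex.exp (-(Real.pi * (1 / t)) * ‖x‖ ^ 2))
    simp only [Equiv.ofBijective_apply] at hw_tsum
    rw [tsum_mul_left, hw_tsum] at hpois
    rw [← hpois, ← b.equivFun.symm.toEquiv.tsum_eq]
    refine tsum_congr fun n => ?_
    change _ = Complex.exp _
    rw [hAint]
    rfl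
  · have h1 : Integrable (fun x : E => Complex.exp (-(Real.pi * t) * ‖x‖ ^ 2)) := by
      simpa using GaussianFourier.integrable_cexp_neg_mul_sq_norm_add hπt 0 (0 : E)
    have h2 : Integrable (fun x : E => Complex.exp (-(Real.pi * t) * ‖x‖ ^ 2))
        (Measure.map A volume) := by
      rw [hc]; exact h1.smul_measure_nnreal
    exact (integrable_map_equiv A.toHomeomorph.toMeasurableEquiv _).1 h2
  · intro K
    obtain ⟨R, hR⟩ := (K.isCompact.image A.continuous).isBounded.exists_norm_le
    have hs := (summable_exp_neg_mul_norm_sq L (a := Real.pi * t.re / 2)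
      (by have := mul_pos Real.pi_pos ht; linarith)).mul_left (Real.exp (Real.pi * t.re * R ^ 2))
    rw [← b.equivFun.symm.toEquiv.summable_iff] at hs
    refine Summable.of_nonneg_of_le (fun n => norm_nonneg _) (fun n => ?_) hs
    refine (ContinuousMap.norm_le _ (mul_pos (Real.exp_pos _) (Real.exp_pos _)).le).2 fun v => ?_
    change ‖g (v + intPoint n)‖ ≤ Real.exp _ * Real.exp (_ * ‖b.equivFun.symm n‖ ^ 2)
    rw [hnorm, ← Real.exp_add, Real.exp_le_exp, map_add, hAint]
    have hv : ‖A v‖ ≤ R := hR _ ⟨v, v.2, rfl⟩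
    have h3 : ‖b.equivFun.symm n‖ ≤ ‖A v + (b.equivFun.symm n : L)‖ + R := by
      have : ((b.equivFun.symm n : L) : E) = (A v + (b.equivFun.symm n : L)) - A v := by abel
      change ‖((b.equivFun.symm n : L) : E)‖ ≤ _
      conv_lhs => rw [this]
      exact (norm_sub_le _ _).trans (by gcongr)
    set p := ‖b.equivFun.symm n‖
    set q := ‖A v + (b.equivFun.symm n : L)‖
    have h4 : p ^ 2 ≤ 2 * q ^ 2 + 2 * R ^ 2 := by
      have h0 : 0 ≤ p := norm_nonneg _
      nlinarith [sq_nonneg (q - R), pow_le_pow_left₀ h0 h3 2]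
    have h5 : 0 < Real.pi * t.re := mul_pos Real.pi_pos ht
    nlinarith
  · simp_rw [hcoeff]
    refine Summable.mul_left _ ?_
    exact (Equiv.ofBijective w hwbij).summable_iff.2 (summable_cexp_neg_mul_norm_sq L ht')

/-- The **theta inversion formula** for a self-dual lattice. -/
theorem tsum_gaussian_eq_of_selfDual
    (hdual : ∀ y : E, y ∈ L ↔ ∀ x ∈ L, ∃ k : ℤ, ⟪x, y⟫ = (k : ℝ)) {t : ℂ} (ht : 0 < t.re) :
    ∑' x : L, Complex.exp (-(Real.pi * t) * ‖x‖ ^ 2) =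
      (1 / t) ^ (Module.finrank ℝ E / 2 : ℂ) *
        ∑' x : L, Complex.exp (-(Real.pi * (1 / t)) * ‖x‖ ^ 2) := by
  obtain ⟨c, hc⟩ := exists_tsum_gaussian_eq_of_selfDual L hdual
  have hpos : 0 < ∑' x : L, Real.exp (-(Real.pi) * ‖x‖ ^ 2) :=
    (summable_exp_neg_mul_norm_sq L Real.pi_pos).tsum_pos (fun _ => (Real.exp_pos _).le) 0
      (Real.exp_pos _)
  have h1 := hc 1 (by simp)
  have h2 : ∑' x : L, Complex.exp (-(Real.pi * 1) * ‖x‖ ^ 2) =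
      ((∑' x : L, Real.exp (-(Real.pi) * ‖x‖ ^ 2) : ℝ) : ℂ) := by
    push_cast
    simp
  rw [div_one, h2, Complex.one_cpow, mul_one] at h1
  have hc1 : c = 1 :=
    mul_right_cancel₀ (Complex.ofReal_ne_zero.2 hpos.ne') (h1.symm.trans (one_mul _).symm)
  rw [hc t ht, hc1, one_mul]

end LatticeGaussianSum

section ThetaSeries

open UpperHalfPlane ModularForm ModularFormClass MatrixGroups Manifold

variable {E : Type*} [NormedAddCommGroup E] [InnerProductSpace ℝ E] [FiniteDimensional ℝ E]
  (L : Submodule ℤ E) [DiscreteTopology L]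

/-- The theta series of a lattice. -/
noncomputable def latticeTheta (τ : ℍ) : ℂ :=
  ∑' x : L, Complex.exp (-(Real.pi * (-Complex.I * τ)) * ‖x‖ ^ 2)

/-- The number of vectors of norm `2 * m` in a lattice. -/
noncomputable def evenShellCard (m : ℕ) : ℕ := {x : E | x ∈ L ∧ ⟪x, x⟫ = 2 * (m : ℝ)}.ncard

lemma neg_I_mul_re_pos (τ : ℍ) : 0 < (-Complex.I * τ : ℂ).re := by
  simpa using τ.im_pos

lemma mdifferentiable_latticeTheta : MDiff (latticeTheta L) := by
  rw [UpperHalfPlane.mdifferentiable_iff]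
  intro z hz
  have hz' : 0 < Real.pi * (z.im / 2) := mul_pos Real.pi_pos (half_pos hz)
  have hopen : IsOpen {w : ℂ | z.im / 2 < w.im} := isOpen_lt continuous_const Complex.continuous_im
  have h := Complex.differentiableOn_tsum_of_summable_norm
    (F := fun (x : L) (w : ℂ) => Complex.exp (-(Real.pi * (-Complex.I * w)) * ‖x‖ ^ 2))
    (summable_exp_neg_mul_norm_sq L hz') (fun x => by fun_prop) hopen fun x w hw => by
      rw [Complex.norm_exp, ← Complex.ofReal_pow, Complex.re_mul_ofReal, Real.exp_le_exp]
      have : Real.pi * (z.im / 2) ≤ Real.pi * w.im :=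
        mul_le_mul_of_nonneg_left (le_of_lt hw) Real.pi_pos.le
      have hre : (-(Real.pi * (-Complex.I * w))).re = -(Real.pi * w.im) := by simp
      rw [hre]
      exact mul_le_mul_of_nonneg_right (by linarith) (sq_nonneg _)
  have hmem : z ∈ {w : ℂ | z.im / 2 < w.im} := half_lt_self (show 0 < z.im from hz)
  refine ((h.differentiableAt (hopen.mem_nhds hmem)).congr_of_eventuallyEq
    ?_).differentiableWithinAt
  filter_upwards [isOpen_upperHalfPlaneSet.mem_nhds hz] with w hw
  simp [latticeTheta, ofComplex_apply_of_im_pos hw]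

lemma hasSum_latticeTheta (heven : ∀ x ∈ L, ∃ k : ℤ, ⟪x, x⟫ = 2 * (k : ℝ)) (τ : ℍ) :
    HasSum (fun m ↦ (evenShellCard L m : ℂ) • Function.Periodic.qParam 1 τ ^ m)
      (latticeTheta L τ) := by
  have hN (x : L) : ∃ n : ℕ, ⟪(x : E), (x : E)⟫ = 2 * (n : ℝ) := by
    obtain ⟨k, hk⟩ := heven x x.2
    have hk0 : 0 ≤ k := by
      have := real_inner_self_nonneg (x := (x : E))
      rw [hk] at this
      exact_mod_cast (by linarith : (0 : ℝ) ≤ k)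
    lift k to ℕ using hk0
    exact ⟨k, hk⟩
  choose N hN using hN
  have hterm (x : L) : Complex.exp (-(Real.pi * (-Complex.I * τ)) * ‖x‖ ^ 2) =
      Function.Periodic.qParam 1 τ ^ N x := by
    have h1 : ((‖x‖ : ℂ)) ^ 2 = 2 * N x := by
      rw [Submodule.coe_norm]
      exact_mod_cast (real_inner_self_eq_norm_sq (x : E)).symm.trans (hN x)
    rw [h1, Function.Periodic.qParam, ← Complex.exp_nat_mul]
    congr 1
    simp
    ring
  have hs := (summable_cexp_neg_mul_norm_sq L (neg_I_mul_re_pos τ)).hasSum.tsum_fiberwise N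
  convert! hs using 2 with m
  have hcard : evenShellCard L m = Nat.card (N ⁻¹' {m}) := by
    rw [Nat.card_coe_set_eq, ← Set.ncard_image_of_injective _ Subtype.val_injective, evenShellCard]
    congr 1
    ext x
    constructor
    · rintro ⟨hx, h⟩
      refine ⟨⟨x, hx⟩, ?_, rfl⟩
      have := hN ⟨x, hx⟩
      rw [h] at this
      exact_mod_cast (by linarith : (N ⟨x, hx⟩ : ℝ) = m)
    · rintro ⟨y, rfl, rfl⟩
      exact ⟨y.2, hN y⟩
  rw [hcard, tsum_congr (g := fun _ => Function.Periodic.qParam 1 τ ^ m) fun x => by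
    rw [hterm, (x.2 : N x = m)], tsum_const]
  simp

lemma latticeTheta_slash_T (heven : ∀ x ∈ L, ∃ k : ℤ, ⟪x, x⟫ = 2 * (k : ℝ)) (k : ℤ) :
    latticeTheta L ∣[k] ModularGroup.T = latticeTheta L := by
  ext τ
  have hq : Function.Periodic.qParam 1 (((1 : ℝ) +ᵥ τ : ℍ) : ℂ) = Function.Periodic.qParam 1 τ := by
    simp [Function.Periodic.qParam, mul_add, Complex.exp_add]
  have h := hasSum_latticeTheta L heven ((1 : ℝ) +ᵥ τ)
  rw [hq] at h
  rw [SL_slash_apply, ModularGroup.denom_apply, modular_T_smul,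
    h.unique (hasSum_latticeTheta L heven τ)]
  simp [ModularGroup.T]

variable [IsZLattice ℝ L]

lemma latticeTheta_slash_S
    (hdual : ∀ y : E, y ∈ L ↔ ∀ x ∈ L, ∃ k : ℤ, ⟪x, y⟫ = (k : ℝ)) {k : ℕ}
    (hdim : Module.finrank ℝ E = 2 * k) (hk : 4 ∣ k) :
    latticeTheta L ∣[(k : ℤ)] ModularGroup.S = latticeTheta L := by
  ext τ
  have hτ : (τ : ℂ) ≠ 0 := τ.ne_zero
  have h := tsum_gaussian_eq_of_selfDual L hdual (neg_I_mul_re_pos τ)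
  have h1 : 1 / (-Complex.I * τ : ℂ) = -Complex.I * ((-(τ : ℂ))⁻¹) := by
    field_simp
    simp
  have h2 : (1 / (-Complex.I * τ : ℂ)) ^ (Module.finrank ℝ E / 2 : ℂ) = ((τ : ℂ) ^ k)⁻¹ := by
    obtain ⟨d, rfl⟩ := hk
    rw [hdim, show ((2 * (4 * d) : ℕ) : ℂ) / 2 = ((4 * d : ℕ) : ℂ) by push_cast; ring,
      Complex.cpow_natCast, h1, ← inv_pow, pow_mul, pow_mul]
    congr 1
    rw [mul_pow, neg_pow, Complex.I_pow_four, inv_neg, neg_pow]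
    norm_num
  rw [h2, h1] at h
  rw [SL_slash_apply, UpperHalfPlane.modular_S_smul]
  have h3 : latticeTheta L τ = _ := h
  rw [h3, mul_comm]
  simp [latticeTheta, ModularGroup.denom_S]

/-- The theta series of an even self-dual lattice as a modular form of level one. -/
noncomputable def latticeThetaForm (heven : ∀ x ∈ L, ∃ k : ℤ, ⟪x, x⟫ = 2 * (k : ℝ))
    (hdual : ∀ y : E, y ∈ L ↔ ∀ x ∈ L, ∃ k : ℤ, ⟪x, y⟫ = (k : ℝ)) {k : ℕ}
    (hdim : Module.finrank ℝ E = 2 * k) (hk : 4 ∣ k) : ModularForm 𝒮ℒ k where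
  toFun := latticeTheta L
  slash_action_eq' A hA := by
    obtain ⟨A, rfl⟩ := hA
    exact SlashInvariantForm.slash_action_generators_SL2Z (latticeTheta_slash_S L hdual hdim hk)
      (latticeTheta_slash_T L heven k) A
  holo' := mdifferentiable_latticeTheta L
  bdd_at_cusps' hc := by
    rw [Subgroup.IsArithmetic.isCusp_iff_isCusp_SL2Z] at hc
    rw [OnePoint.isBoundedAt_iff_forall_SL2Z hc]
    intro γ _
    rw [SlashInvariantForm.slash_action_generators_SL2Z (latticeTheta_slash_S L hdual hdim hk)
      (latticeTheta_slash_T L heven k)]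
    exact isBoundedAtImInfty_of_hasSum_qExpansion one_pos (hasSum_latticeTheta L heven)

lemma coeff_qExpansion_latticeThetaForm (heven : ∀ x ∈ L, ∃ k : ℤ, ⟪x, x⟫ = 2 * (k : ℝ))
    (hdual : ∀ y : E, y ∈ L ↔ ∀ x ∈ L, ∃ k : ℤ, ⟪x, y⟫ = (k : ℝ)) {k : ℕ}
    (hdim : Module.finrank ℝ E = 2 * k) (hk : 4 ∣ k) (m : ℕ) :
    (qExpansion 1 (latticeThetaForm L heven hdual hdim hk)).coeff m = evenShellCard L m :=
  (ModularFormClass.qExpansion_coeff_unique one_pos one_mem_strictPeriods_SL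
    (f := latticeThetaForm L heven hdual hdim hk) (hasSum_latticeTheta L heven) m).symm

end ThetaSeries

section WeightTwelve

open UpperHalfPlane ModularForm ModularFormClass MatrixGroups EisensteinSeries

/-- The modular form of weight twelve with `q`-expansion `1 + 0 * q + ⋯`. -/
noncomputable def extremalForm : ModularForm 𝒮ℒ 12 :=
  (7 / 12 : ℂ) • ModularForm.mcast (by decide) (E₄.pow 3) +
    (5 / 12 : ℂ) • ModularForm.mcast (by decide) (E₆.pow 2)

lemma qExpansion_extremalForm :
    qExpansion 1 extremalForm = (7 / 12 : ℂ) • qExpansion 1 E₄ ^ 3 +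
      (5 / 12 : ℂ) • qExpansion 1 E₆ ^ 2 := by
  rw [extremalForm, FunLike.coe_add,
    ModularForm.qExpansion_add one_pos one_mem_strictPeriods_SL,
    FunLike.coe_smul, FunLike.coe_smul,
    ModularForm.qExpansion_smul one_pos one_mem_strictPeriods_SL,
    ModularForm.qExpansion_smul one_pos one_mem_strictPeriods_SL, coe_mcast, coe_mcast,
    ModularForm.qExpansion_pow one_pos one_mem_strictPeriods_SL,
    ModularForm.qExpansion_pow one_pos one_mem_strictPeriods_SL]

lemma coeff_qExpansion_E₄ (m : ℕ) :
    (qExpansion 1 E₄).coeff m = if m = 0 then 1 else 240 * (ArithmeticFunction.sigma 3 m : ℂ) := by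
  rw [E_qExpansion_coeff (by norm_num) ⟨2, rfl⟩]
  split_ifs
  · rfl
  · norm_num [bernoulli_eq_bernoulli'_of_ne_one]

lemma coeff_qExpansion_E₆ (m : ℕ) :
    (qExpansion 1 E₆).coeff m =
      if m = 0 then 1 else -504 * (ArithmeticFunction.sigma 5 m : ℂ) := by
  rw [E_qExpansion_coeff (by norm_num) ⟨3, rfl⟩]
  split_ifs
  · rfl
  · norm_num [show bernoulli 6 = 1 / 42 by decide +kernel]

lemma coeff_qExpansion_extremalForm :
    (qExpansion 1 extremalForm).coeff 0 = 1 ∧ (qExpansion 1 extremalForm).coeff 1 = 0 ∧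
      (qExpansion 1 extremalForm).coeff 2 = 196560 ∧
      (qExpansion 1 extremalForm).coeff 3 = 16773120 := by
  have h32 : ArithmeticFunction.sigma 3 2 = 9 := by decide
  have h33 : ArithmeticFunction.sigma 3 3 = 28 := by decide
  have h52 : ArithmeticFunction.sigma 5 2 = 33 := by decide
  have h53 : ArithmeticFunction.sigma 5 3 = 244 := by decide
  refine ⟨?_, ?_, ?_, ?_⟩ <;> rw [qExpansion_extremalForm] <;>
  norm_num [-PowerSeries.coeff_zero_eq_constantCoeff, pow_succ, PowerSeries.coeff_mul,
    Finset.Nat.antidiagonal_succ, coeff_qExpansion_E₄, coeff_qExpansion_E₆, h32, h33, h52, h53]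

/-- A modular form of weight twelve is determined by the first two coefficients. -/
lemma eq_of_coeff_zero_one_eq {f g : ModularForm 𝒮ℒ 12}
    (h0 : (qExpansion 1 f).coeff 0 = (qExpansion 1 g).coeff 0)
    (h1 : (qExpansion 1 f).coeff 1 = (qExpansion 1 g).coeff 1) : f = g := by
  rw [← sub_eq_zero]
  apply sturm_bound_levelOne
  rw [FunLike.coe_sub, ModularForm.qExpansion_sub one_pos one_mem_strictPeriods_SL]
  have : (2 : ℕ∞) ≤ (qExpansion 1 f - qExpansion 1 g).order := by
    refine PowerSeries.nat_le_order _ 2 fun i hi => ?_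
    interval_cases i
    · rw [map_sub, h0, sub_self]
    · rw [map_sub, h1, sub_self]
  exact lt_of_lt_of_le (Nat.cast_lt.2 (show (12 : ℤ).toNat / 12 < 2 by decide)) this

end WeightTwelve

section LatticeShells

lemma evenShellCard_zero {E : Type*} [NormedAddCommGroup E] [InnerProductSpace ℝ E]
    (L : Submodule ℤ E) : evenShellCard L 0 = 1 := by
  rw [evenShellCard, Set.ncard_eq_one]
  refine ⟨0, Set.ext fun x => ?_⟩
  simp +contextual

lemma evenShellCard_one {E : Type*} [NormedAddCommGroup E] [InnerProductSpace ℝ E]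
    {L : Submodule ℤ E} (hmin : ∀ x ∈ L, x ≠ 0 → 4 ≤ ⟪x, x⟫) : evenShellCard L 1 = 0 := by
  rw [evenShellCard]
  convert Set.ncard_empty E
  refine Set.eq_empty_of_forall_notMem ?_
  rintro x ⟨hx, h⟩
  have := hmin x hx (by rintro rfl; simp at h)
  rw [h] at this
  norm_num at this

end LatticeShells

/-- the Leech lattice has exactly 196560 vectors of norm 4 and exactly
16773120 vectors of norm 6. -/
theorem statement13
    (L : Submodule ℤ (EuclideanSpace ℝ (Fin 24)))
    [DiscreteTopology L] [IsZLattice ℝ L]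
    (heven : ∀ x ∈ L, ∃ k : ℤ, ⟪x, x⟫ = 2 * (k : ℝ))
    (hdual : ∀ y : EuclideanSpace ℝ (Fin 24), y ∈ L ↔ ∀ x ∈ L, ∃ k : ℤ, ⟪x, y⟫ = (k : ℝ))
    (hmin : ∀ x ∈ L, x ≠ 0 → 4 ≤ ⟪x, x⟫)
    :
    {x : EuclideanSpace ℝ (Fin 24) | x ∈ L ∧ ⟪x, x⟫ = 4}.ncard = 196560 ∧
    {x : EuclideanSpace ℝ (Fin 24) | x ∈ L ∧ ⟪x, x⟫ = 6}.ncard = 16773120 := by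
  have hdim : Module.finrank ℝ (EuclideanSpace ℝ (Fin 24)) = 2 * 12 := by simp
  have hcoeff := coeff_qExpansion_latticeThetaForm L heven hdual hdim ⟨3, rfl⟩
  obtain ⟨h0, h1, h2, h3⟩ := coeff_qExpansion_extremalForm
  have heq : latticeThetaForm L heven hdual hdim ⟨3, rfl⟩ = extremalForm :=
    eq_of_coeff_zero_one_eq (by rw [hcoeff, h0, evenShellCard_zero, Nat.cast_one])
      (by rw [hcoeff, h1, evenShellCard_one hmin, Nat.cast_zero])
  rw [heq] at hcoeff
  have hshell2 : evenShellCard L 2 = 196560 := by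
    exact_mod_cast (hcoeff 2).symm.trans h2
  have hshell3 : evenShellCard L 3 = 16773120 := by
    exact_mod_cast (hcoeff 3).symm.trans h3
  rw [← hshell2, ← hshell3, evenShellCard, evenShellCard]
  norm_num
end
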